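/- Theorem (polytopal algebra of the quotient polytope; Theorem 1.3). Let K ⊆ {1, …, n} and assume that the W-symmetric polytope P is nondegenerate and simple. Then: (i) every s ∈ W_K maps facets of P to facets of P and satisfies s(ℓ_F) = ℓ_{s(F)} for every facet F, and the ℝ-algebra automorphism of the polynomial ring ℝ[X_F : F ∈ 𝔉(P)] determined by X_F ↦ X_{s(F)} maps the ideal I_P + J_P onto itself, so that W_K acts on the polytopal algebra 𝒜(P) by ℝ-algebra automorphisms; (ii) the set P ∩ C_K is a full-dimensional polytope, and there exists an ℝ-algebra isomorphism between 𝒜(P ∩ C_K) and the invariant subalgebra 𝒜(P)^{W_K} consisting of the elements of 𝒜(P) fixed by the action of every element of W_K. -/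

import Mathlib

open scoped RealInnerProductSpace

noncomputable section

variable {V : Type*} [NormedAddCommGroup V] [InnerProductSpace ℝ V]

/-- The reflection `r_α` across the hyperplane orthogonal to `α`:
`r_α(x) = x − (2⟪x,α⟫/⟪α,α⟫) α`. -/
def reflMap (α : V) : V → V := fun x => x - (2 * ⟪x, α⟫ / ⟪α, α⟫) • α

/-- The hyperplane `H_α = {x | ⟪x, α⟫ = 0}` fixed by `reflMap α`. -/
def hplane (α : V) : Set V := {x : V | ⟪x, α⟫ = 0}

/-- `F` is a facet of the full-dimensional polytope `Q`: an exposed face whose affine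
span has dimension `n − 1` (where `n = dim V`). -/
def IsFacet (Q F : Set V) : Prop :=
  IsExposed ℝ Q F ∧ Module.finrank ℝ (affineSpan ℝ F).direction + 1 = Module.finrank ℝ V

open Classical in
/-- The barycenter of a nonempty face: the centroid of its finitely many extreme points. -/
def barycenter (F : Set V) : V :=
  if h : (Set.extremePoints ℝ F).Finite then h.toFinset.centroid ℝ id else 0

/-- A full-dimensional polytope is simple if every extreme point lies in exactly `n` facets. -/
def IsSimple (Q : Set V) : Prop :=
  ∀ v ∈ Set.extremePoints ℝ Q, {F : Set V | IsFacet Q F ∧ v ∈ F}.ncard = Module.finrank ℝ V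

/-- The cone `C_K = {x | ⟪x, α_k⟫ ≥ 0 for all k ∈ K}`. -/
def cham {n : ℕ} (α : Fin n → V) (K : Set (Fin n)) : Set V :=
  {x : V | ∀ k ∈ K, 0 ≤ ⟪x, α k⟫}

/-- The parabolic subgroup `W_K`, realized as the submonoid of `Function.End V`
generated by the simple reflections `r_{α_k}`, `k ∈ K` (since each generator is an
involution, this submonoid coincides with the generated group). -/
def WK {n : ℕ} (α : Fin n → V) (K : Set (Fin n)) : Submonoid (Function.End V) :=
  Submonoid.closure {g : Function.End V | ∃ k ∈ K, g = reflMap (α k)}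

/-- A reduced root system of full rank `n` in `V` with a fixed simple system `α`. -/
structure RootSystemData (V : Type*) [NormedAddCommGroup V] [InnerProductSpace ℝ V]
    (n : ℕ) : Type _ where
  α : Fin n → V
  R : Set V
  hn : 1 ≤ n
  hdim : Module.finrank ℝ V = n
  hR_fin : R.Finite
  hR_ne0 : ∀ β ∈ R, β ≠ 0
  hR_refl : ∀ β ∈ R, reflMap β '' R = R
  hR_red : ∀ β ∈ R, R ∩ {x : V | ∃ c : ℝ, x = c • β} = {β, -β}
  hα_mem : ∀ i, α i ∈ R
  hα_indep : LinearIndependent ℝ α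
  hα_span : Submodule.span ℝ (Set.range α) = ⊤
  hα_sign : ∀ β ∈ R, ∃ c : Fin n → ℝ, β = ∑ i, c i • α i ∧
    ((∀ i, 0 ≤ c i) ∨ (∀ i, c i ≤ 0))

/-- A `W`-symmetric polytope datum: a root system together with a finite nonempty
set `Λ` contained in the fundamental chamber `C_S`. -/
structure PermSetup (V : Type*) [NormedAddCommGroup V] [InnerProductSpace ℝ V]
    (n : ℕ) extends RootSystemData V n where
  Λ : Set V
  hΛ_fin : Λ.Finite
  hΛ_ne : Λ.Nonempty
  hΛ_cham : Λ ⊆ cham α Set.univ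

/-- The `W`-symmetric polytope `P = conv(⋃_{w ∈ W} w(Λ))`. -/
def PermSetup.P {n : ℕ} (S : PermSetup V n) : Set V :=
  convexHull ℝ (⋃ w ∈ WK S.α Set.univ, Set.image w S.Λ)

/-- `P` is nondegenerate: `⟪λ, α_i⟫ > 0` for every `λ ∈ Λ` and every `i`. -/
def PermSetup.Nondegenerate {n : ℕ} (S : PermSetup V n) : Prop :=
  ∀ l ∈ S.Λ, ∀ i, 0 < ⟪l, S.α i⟫

/-- The type of facets of `Q`. -/
abbrev Facets (Q : Set V) := {F : Set V // IsFacet Q F}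

/-- `u` is the unit outward normal of the facet `F` of `Q`. -/
def IsOutwardNormal (Q F : Set V) (u : V) : Prop :=
  ‖u‖ = 1 ∧ F = {x ∈ Q | ∀ y ∈ Q, ⟪u, y⟫ ≤ ⟪u, x⟫}

open Classical in
/-- The unit outward normal `ℓ_F` of a facet `F` of `Q`. -/
def normalVec (Q F : Set V) : V :=
  if h : ∃ u : V, IsOutwardNormal Q F u then h.choose else 0

/-- The Stanley–Reisner ideal `I_Q`, generated by the square-free monomials
`X_{F_1} ⋯ X_{F_p}` with `F_1 ∩ ⋯ ∩ F_p = ∅`. -/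
def srIdeal (Q : Set V) : Ideal (MvPolynomial (Facets Q) ℝ) :=
  Ideal.span {p | ∃ t : Finset (Facets Q), (⋂ F ∈ t, (F.1 : Set V)) = ∅ ∧
    p = ∏ F ∈ t, MvPolynomial.X F}

/-- The ideal `J_Q` generated by the linear forms `∑_F ⟪u, ℓ_F⟫ X_F` for `u ∈ V`. -/
def linIdeal (Q : Set V) : Ideal (MvPolynomial (Facets Q) ℝ) :=
  Ideal.span {p | ∃ u : V,
    p = ∑ᶠ F : Facets Q, MvPolynomial.C ⟪u, normalVec Q F.1⟫ * MvPolynomial.X F}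

/-- The ideal `I_Q + J_Q`. -/
def polyIdeal (Q : Set V) : Ideal (MvPolynomial (Facets Q) ℝ) := srIdeal Q + linIdeal Q

/-- The polytopal algebra `𝒜(Q) = ℝ[X_F : F ∈ 𝔉(Q)]/(I_Q + J_Q)`. -/
abbrev PolyAlg (Q : Set V) := MvPolynomial (Facets Q) ℝ ⧸ polyIdeal Q

/-- The quotient map onto the polytopal algebra. -/
def polyMk (Q : Set V) : MvPolynomial (Facets Q) ℝ →ₐ[ℝ] PolyAlg Q :=
  Ideal.Quotient.mkₐ ℝ (polyIdeal Q)

/-- The invariant subalgebra of an action `ρ` of a monoid `G` by `ℝ`-algebra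
automorphisms: the elements fixed by every `ρ g`. -/
def invariants {A : Type*} [CommRing A] [Algebra ℝ A] {G : Type*} [Monoid G]
    (ρ : G →* (A ≃ₐ[ℝ] A)) : Subalgebra ℝ A where
  carrier := {a : A | ∀ g : G, ρ g a = a}
  mul_mem' := fun {a b} ha hb g => by
    simp only [Set.mem_setOf_eq] at ha hb ⊢
    rw [map_mul, ha g, hb g]
  one_mem' := fun g => map_one (ρ g)
  add_mem' := fun {a b} ha hb g => by
    simp only [Set.mem_setOf_eq] at ha hb ⊢
    rw [map_add, ha g, hb g]
  zero_mem' := fun g => map_zero (ρ g)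
  algebraMap_mem' := fun r g => (ρ g).commutes r

/-! ### Algebra of a complex with a reflection action and its fundamental domain -/

section FoldData

open MvPolynomial

/-- A complex `Δ` on the index set `ι` of a family of vectors `ℓ`, acted on by a group `G` of
isometries generated by the reflections `r_{α_k}`, `k ∈ K`, with fundamental domain `D`. -/
structure FoldData (G : Subgroup (V ≃ₗᵢ[ℝ] V)) (ι : Type*) [DecidableEq ι] [MulAction G ι]
    {n : ℕ} (K : Set (Fin n)) where
  α : Fin n → V
  ω : Fin n → V
  ℓ : ι → V
  Δ : Finset ι → Prop
  D : Set ι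
  dom : ι → ι
  α_ne : ∀ i, α i ≠ 0
  dual : ∀ i j, ⟪ω i, α j⟫ = if i = j then (1 : ℝ) else 0
  expand : ∀ u, u = ∑ i, ⟪u, α i⟫ • ω i
  ℓ_smul : ∀ (g : G) F, ℓ (g • F) = (g : V ≃ₗᵢ[ℝ] V) (ℓ F)
  Δ_smul : ∀ (g : G) T, Δ T → Δ (T.image (g • ·))
  dom_mem : ∀ F, dom F ∈ D
  dom_orbit : ∀ F, ∃ g : G, dom F = g • F
  move : ∀ T, Δ T → ∃ g : G, ∀ F ∈ T, g • F ∈ D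
  fund : ∀ (g : G) F, F ∈ D → g • F ∈ D → g • F = F
  stab : ∀ (g : G) F, F ∈ D → g • F = F → ∀ k ∈ K, ⟪ℓ F, α k⟫ ≠ 0 →
    (g : V ≃ₗᵢ[ℝ] V) (ω k) = ω k
  fix : ∀ (g : G) u, (∀ k ∈ K, ⟪u, α k⟫ = 0) → (g : V ≃ₗᵢ[ℝ] V) u = u
  refl : ∀ k ∈ K, ∃ r : G, (r : V ≃ₗᵢ[ℝ] V) (α k) = -α k ∧
    ∀ F, F ∈ D → ⟪ℓ F, α k⟫ = 0 → r • F = F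

namespace FoldData

variable {G : Subgroup (V ≃ₗᵢ[ℝ] V)} {ι κ : Type*} [Fintype ι] [DecidableEq ι]
  [MulAction G ι] {n : ℕ} {K : Set (Fin n)} (S : FoldData G ι K)

/-- The Stanley–Reisner ideal of the complex. -/
def sr : Ideal (MvPolynomial ι ℝ) := Ideal.span {p | ∃ t : Finset ι, ¬ S.Δ t ∧ p = ∏ F ∈ t, X F}

/-- The linear form attached to a vector. -/
def lin (u : V) : MvPolynomial ι ℝ := ∑ F, C ⟪u, S.ℓ F⟫ * X F

/-- The ideal generated by the linear forms. -/
def linI : Ideal (MvPolynomial ι ℝ) := Ideal.span {p | ∃ u, p = S.lin u}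

/-- The action of the group on polynomials. -/
def act (G : Subgroup (V ≃ₗᵢ[ℝ] V)) {ι : Type*} [MulAction G ι] (g : G) :
    MvPolynomial ι ℝ →ₐ[ℝ] MvPolynomial ι ℝ := rename (g • ·)

omit [Fintype ι] [DecidableEq ι] in
theorem act_act (g h : G) (p : MvPolynomial ι ℝ) : act G g (act G h p) = act G (g * h) p := by
  simp only [act, rename_rename]
  congr 2
  funext F
  simp [mul_smul]

omit [Fintype ι] [DecidableEq ι] in
@[simp] theorem act_one (p : MvPolynomial ι ℝ) : act G 1 p = p := by
  rw [act, show ((1 : G) • · : ι → ι) = id by funext F; simp, rename_id_apply]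

omit [Fintype ι] [DecidableEq ι] in
@[simp] theorem act_X (g : G) (F : ι) : act G g (X F) = X (g • F) := by simp [act]

omit [Fintype ι] [DecidableEq ι] in
@[simp] theorem act_C (g : G) (c : ℝ) : act G g (C c : MvPolynomial ι ℝ) = C c := by simp [act]

omit [Fintype ι] in
theorem act_sr (g : G) {p : MvPolynomial ι ℝ} (hp : p ∈ S.sr) : act G g p ∈ S.sr := by
  have : S.sr ≤ S.sr.comap (act G g) := by
    refine Ideal.span_le.2 ?_
    rintro _ ⟨t, ht, rfl⟩
    refine Ideal.subset_span ⟨t.image (g • ·), fun h => ht ?_, ?_⟩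
    · have := S.Δ_smul g⁻¹ _ h
      rwa [Finset.image_image, show ((g⁻¹ • ·) ∘ (g • ·) : ι → ι) = id by funext F; simp,
        Finset.image_id] at this
    · simp only [map_prod, act_X]
      rw [Finset.prod_image fun x _ y _ h => MulAction.injective g h]
  exact this hp

theorem act_lin (g : G) (u : V) : act G g (S.lin u) = S.lin ((g : V ≃ₗᵢ[ℝ] V) u) := by
  simp only [lin, map_sum, map_mul, act_C, act_X]
  refine Fintype.sum_equiv (MulAction.toPerm g) _ _ fun F => ?_
  simp [S.ℓ_smul]

theorem act_linI (g : G) {p : MvPolynomial ι ℝ} (hp : p ∈ S.linI) : act G g p ∈ S.linI := by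
  have : S.linI ≤ S.linI.comap (act G g) := by
    refine Ideal.span_le.2 ?_
    rintro _ ⟨u, rfl⟩
    exact Ideal.subset_span ⟨_, S.act_lin g u⟩
  exact this hp

/-- The defining ideal. -/
def ideal : Ideal (MvPolynomial ι ℝ) := S.sr + S.linI

theorem sr_le : S.sr ≤ S.ideal := le_sup_left

theorem linI_le : S.linI ≤ S.ideal := le_sup_right

theorem act_ideal (g : G) {p : MvPolynomial ι ℝ} (hp : p ∈ S.ideal) : act G g p ∈ S.ideal := by
  have : S.ideal ≤ S.ideal.comap (act G g) :=
    sup_le (fun _ h => S.sr_le (S.act_sr g h)) (fun _ h => S.linI_le (S.act_linI g h))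
  exact this hp

omit [Fintype ι] in
theorem dom_smul (g : G) (F : ι) : S.dom (g • F) = S.dom F := by
  obtain ⟨a, ha⟩ := S.dom_orbit F
  obtain ⟨b, hb⟩ := S.dom_orbit (g • F)
  have h : S.dom (g • F) = (b * g * a⁻¹) • S.dom F := by rw [ha, hb]; simp [mul_smul]
  rw [h]
  exact S.fund _ _ (S.dom_mem _) (h ▸ S.dom_mem _)

omit [Fintype ι] in
theorem dom_of_mem {F : ι} (hF : F ∈ S.D) : S.dom F = F := by
  obtain ⟨a, ha⟩ := S.dom_orbit F
  rw [ha]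
  exact S.fund _ _ hF (ha ▸ S.dom_mem _)

/-- The orbit sum of the variables. -/
def Z (F : ι) : MvPolynomial ι ℝ := ∑ H, if S.dom H = F then X H else 0

/-- The invariant piecewise linear function that agrees with `u` on the fundamental domain. -/
def θ (u : V) : MvPolynomial ι ℝ := ∑ H, C ⟪u, S.ℓ (S.dom H)⟫ * X H

@[simp] theorem act_Z (g : G) (F : ι) : act G g (S.Z F) = S.Z F := by
  simp only [Z, map_sum]
  refine Fintype.sum_equiv (MulAction.toPerm g) _ _ fun H => ?_
  simp only [MulAction.toPerm_apply, S.dom_smul]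
  split_ifs <;> simp

@[simp] theorem act_θ (g : G) (u : V) : act G g (S.θ u) = S.θ u := by
  simp only [θ, map_sum, map_mul, act_C, act_X]
  refine Fintype.sum_equiv (MulAction.toPerm g) _ _ fun H => ?_
  simp [S.dom_smul]

omit [Fintype ι] in
theorem monomial_mem_sr (a : ι →₀ ℕ) (c : ℝ) (ha : ¬ S.Δ a.support) :
    monomial a c ∈ S.sr := by
  have h : (∏ F ∈ a.support, X F : MvPolynomial ι ℝ) ∣ monomial a c := by
    rw [monomial_eq]
    refine Dvd.dvd.mul_left ?_ _
    exact Finset.prod_dvd_prod_of_dvd _ _ fun F hF =>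
      dvd_pow_self _ (Finsupp.mem_support_iff.1 hF)
  exact Ideal.mem_of_dvd _ h (Ideal.subset_span ⟨_, ha, rfl⟩)

omit [Fintype ι] in
theorem X_mul_X_mem_sr (F H : ι) (h : ¬ S.Δ {F, H}) : (X F * X H : MvPolynomial ι ℝ) ∈ S.sr := by
  have hm : ∏ E ∈ ({F, H} : Finset ι), (X E : MvPolynomial ι ℝ) ∈ S.sr :=
    Ideal.subset_span ⟨_, h, rfl⟩
  by_cases hFH : F = H
  · subst hFH
    simp only [Finset.pair_eq_singleton, Finset.prod_singleton] at hm
    exact Ideal.mul_mem_left _ _ hm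
  · rwa [Finset.prod_pair hFH] at hm

open Classical in
/-- Restriction to the fundamental domain. -/
def res : MvPolynomial ι ℝ →ₐ[ℝ] MvPolynomial ι ℝ := aeval fun F => if F ∈ S.D then X F else 0

open Classical in
omit [Fintype ι] in
theorem res_X (F : ι) : S.res (X F) = if F ∈ S.D then X F else 0 := by simp [res]

omit [Fintype ι] in
theorem res_monomial_of_mem (a : ι →₀ ℕ) (c : ℝ) (ha : ∀ F ∈ a.support, F ∈ S.D) :
    S.res (monomial a c) = monomial a c := by
  rw [monomial_eq]
  simp only [map_mul, Finsupp.prod, map_prod, map_pow, res_X]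
  congr 1
  · simp [res]
  · exact Finset.prod_congr rfl fun F hF => by rw [if_pos (ha F hF)]

omit [Fintype ι] in
theorem res_monomial_of_notMem (a : ι →₀ ℕ) (c : ℝ) {F : ι} (hF : F ∈ a.support)
    (hD : F ∉ S.D) : S.res (monomial a c) = 0 := by
  rw [monomial_eq]
  simp only [map_mul, Finsupp.prod, map_prod, map_pow, res_X]
  rw [Finset.prod_eq_zero hF, mul_zero]
  rw [if_neg hD, zero_pow (Finsupp.mem_support_iff.1 hF)]

omit [Fintype ι] in
theorem coeff_res (b : ι →₀ ℕ) (hb : ∀ F ∈ b.support, F ∈ S.D) (p : MvPolynomial ι ℝ) :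
    coeff b (S.res p) = coeff b p := by
  induction p using MvPolynomial.induction_on' with
  | add p q hp hq => simp [hp, hq]
  | monomial a c =>
    by_cases ha : ∀ F ∈ a.support, F ∈ S.D
    · rw [S.res_monomial_of_mem a c ha]
    · push Not at ha
      obtain ⟨F, hF, hD⟩ := ha
      rw [S.res_monomial_of_notMem a c hF hD, coeff_monomial, if_neg, coeff_zero]
      rintro rfl
      exact hD (hb F hF)

omit [Fintype ι] in
/-- An invariant polynomial whose restriction to the fundamental domain is supported off the
complex lies in the Stanley–Reisner ideal. -/
theorem mem_sr_of_invariant (p : MvPolynomial ι ℝ) (hp : ∀ g : G, act G g p = p)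
    (h : ∀ a, coeff a (S.res p) ≠ 0 → ¬ S.Δ a.support) : p ∈ S.sr := by
  rw [p.as_sum]
  refine Ideal.sum_mem _ fun a ha => S.monomial_mem_sr _ _ fun hΔ => ?_
  obtain ⟨g, hg⟩ := S.move _ hΔ
  have hinj : Function.Injective (g • · : ι → ι) := MulAction.injective g
  have hsupp : (a.mapDomain (g • ·)).support = a.support.image (g • ·) :=
    Finsupp.mapDomain_support_of_injective hinj a
  refine h (a.mapDomain (g • ·)) ?_ ?_
  · rw [S.coeff_res]
    · rw [← hp g, act, coeff_rename_mapDomain _ hinj]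
      exact mem_support_iff.1 ha
    · intro F hF
      rw [hsupp, Finset.mem_image] at hF
      obtain ⟨E, hE, rfl⟩ := hF
      exact hg E hE
  · rw [hsupp]
    exact S.Δ_smul g _ hΔ

theorem res_Z {F : ι} (hF : F ∈ S.D) : S.res (S.Z F) = X F := by
  simp only [Z, map_sum]
  rw [Finset.sum_eq_single F]
  · rw [if_pos (S.dom_of_mem hF), res_X, if_pos hF]
  · intro H _ hH
    split_ifs with h
    · rw [res_X, if_neg]
      intro hD
      exact hH ((S.dom_of_mem hD).symm.trans h)
    · simp
  · simp

theorem prod_Z_mem_sr (T : Finset ι) (hT : ∀ F ∈ T, F ∈ S.D) (hΔ : ¬ S.Δ T) :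
    ∏ F ∈ T, S.Z F ∈ S.sr := by
  refine S.mem_sr_of_invariant _ (fun g => by simp) fun a ha => ?_
  rw [map_prod, Finset.prod_congr rfl fun F hF => S.res_Z (hT F hF)] at ha
  have : (∏ F ∈ T, X F : MvPolynomial ι ℝ) = monomial (∑ F ∈ T, Finsupp.single F 1) 1 := by
    rw [monomial_sum_one]
    rfl
  rw [this, coeff_monomial] at ha
  have h2 : ∑ F ∈ T, Finsupp.single F 1 = a := by
    by_contra h
    simp [h] at ha
  have h3 : a.support = T := by
    ext F
    simp [← h2, Finsupp.single_apply, Finsupp.finsetSum_apply]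
  rwa [h3]

/-- On the star of `F ∈ D` with `⟪ℓ_F, α_k⟫ ≠ 0`, the function `θ ω_k` is linear. -/
theorem θ_mul_X_sub_mem {F : ι} (hF : F ∈ S.D) {k : Fin n} (hk : k ∈ K)
    (h : ⟪S.ℓ F, S.α k⟫ ≠ 0) : S.θ (S.ω k) * X F - S.lin (S.ω k) * X F ∈ S.sr := by
  rw [← sub_mul, θ, lin, ← Finset.sum_sub_distrib, Finset.sum_mul]
  refine Ideal.sum_mem _ fun H _ => ?_
  rw [← sub_mul, ← C_sub]
  by_cases hΔ : S.Δ {H, F}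
  · obtain ⟨g, hg⟩ := S.move _ hΔ
    have hgF : g • F = F := S.fund g F hF (hg F (by simp))
    have hgH : S.dom H = g • H := by
      rw [← S.dom_smul g, S.dom_of_mem (hg H (by simp))]
    have hω := S.stab g F hF hgF k hk h
    have : ⟪S.ω k, S.ℓ (S.dom H)⟫ = ⟪S.ω k, S.ℓ H⟫ := by
      rw [hgH, S.ℓ_smul]
      nth_rewrite 1 [← hω]
      simp
    simp [this]
  · rw [mul_assoc]
    exact Ideal.mul_mem_left _ _ (S.X_mul_X_mem_sr _ _ hΔ)

theorem θ_mul_Z_mem {F : ι} (hF : F ∈ S.D) {k : Fin n} (hk : k ∈ K)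
    (h : ⟪S.ℓ F, S.α k⟫ ≠ 0) : S.θ (S.ω k) * S.Z F ∈ S.ideal := by
  have h1 : S.θ (S.ω k) * X F ∈ S.ideal := by
    rw [← sub_add_cancel (S.θ (S.ω k) * X F) (S.lin (S.ω k) * X F)]
    exact Ideal.add_mem _ (S.sr_le (S.θ_mul_X_sub_mem hF hk h))
      (S.linI_le (Ideal.mul_mem_right _ _ (Ideal.subset_span ⟨_, rfl⟩)))
  rw [Z, Finset.mul_sum]
  refine Ideal.sum_mem _ fun H _ => ?_
  split_ifs with hH
  · obtain ⟨g, hg⟩ := S.dom_orbit H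
    have : H = g⁻¹ • F := by rw [← hH, hg]; simp
    rw [this, ← act_X, ← S.act_θ g⁻¹, ← map_mul]
    exact S.act_ideal _ h1
  · simp

theorem θ_eq_lin (u : V) (hu : ∀ k ∈ K, ⟪u, S.α k⟫ = 0) : S.θ u = S.lin u := by
  refine Finset.sum_congr rfl fun H _ => ?_
  obtain ⟨g, hg⟩ := S.dom_orbit H
  rw [hg, S.ℓ_smul]
  nth_rewrite 1 [← S.fix g u hu]
  simp

theorem θ_add (u v : V) : S.θ (u + v) = S.θ u + S.θ v := by
  simp [θ, inner_add_left, add_mul, Finset.sum_add_distrib]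

theorem θ_smul (c : ℝ) (v : V) : S.θ (c • v) = C c * S.θ v := by
  simp [θ, inner_smul_left, Finset.mul_sum, mul_assoc]

theorem lin_add (u v : V) : S.lin (u + v) = S.lin u + S.lin v := by
  simp [lin, inner_add_left, add_mul, Finset.sum_add_distrib]

theorem lin_smul (c : ℝ) (v : V) : S.lin (c • v) = C c * S.lin v := by
  simp [lin, inner_smul_left, Finset.mul_sum, mul_assoc]

theorem θ_eq_sum_Z (u : V) [Fintype S.D] : S.θ u = ∑ F : S.D, C ⟪u, S.ℓ F⟫ * S.Z F := by
  simp only [Z, Finset.mul_sum, θ]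
  rw [Finset.sum_comm]
  refine Finset.sum_congr rfl fun H _ => ?_
  rw [Finset.sum_eq_single ⟨S.dom H, S.dom_mem H⟩]
  · simp
  · intro F _ hF
    rw [if_neg, mul_zero]
    intro h
    exact hF (Subtype.ext h.symm)
  · simp

section Quotient

variable [Fintype K] [Fintype S.D] (e : S.D ⊕ K ≃ κ)

/-- The linear form attached to a vector on the quotient side. -/
def linQ (u : V) : MvPolynomial κ ℝ :=
  ∑ F : S.D, C ⟪u, S.ℓ F⟫ * X (e (.inl F)) -
    ∑ k : K, C (⟪u, S.α k⟫ * ‖S.α k‖⁻¹) * X (e (.inr k))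

/-- The defining ideal on the quotient side. -/
def idealQ : Ideal (MvPolynomial κ ℝ) :=
  Ideal.span ({p | ∃ T : Finset S.D, ¬ S.Δ (T.map (Function.Embedding.subtype _)) ∧
      p = ∏ F ∈ T, X (e (.inl F))} ∪
    {p | ∃ (F : S.D) (k : K), ⟪S.ℓ F, S.α k⟫ ≠ 0 ∧ p = X (e (.inl F)) * X (e (.inr k))} ∪
    {p | ∃ u, p = S.linQ e u})

/-- The comparison map from the quotient side to invariant polynomials. -/
def fold : MvPolynomial κ ℝ →ₐ[ℝ] MvPolynomial ι ℝ :=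
  aeval fun c => Sum.elim (fun F : S.D => S.Z F) (fun k : K => C ‖S.α k‖ * S.θ (S.ω k)) (e.symm c)

omit [Fintype K] [Fintype S.D] in
@[simp] theorem fold_inl (F : S.D) : S.fold e (X (e (.inl F))) = S.Z F := by simp [fold]

omit [Fintype K] [Fintype S.D] in
@[simp] theorem fold_inr (k : K) :
    S.fold e (X (e (.inr k))) = C ‖S.α k‖ * S.θ (S.ω k) := by simp [fold]

omit [Fintype K] [Fintype S.D] in
@[simp] theorem act_fold (g : G) (q : MvPolynomial κ ℝ) :
    act G g (S.fold e q) = S.fold e q := by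
  have : (act G g).comp (S.fold e) = S.fold e := by
    refine MvPolynomial.algHom_ext fun c => ?_
    obtain ⟨c | c, rfl⟩ := e.surjective c <;> simp
  exact DFunLike.congr_fun this q

omit [Fintype ι] [Fintype S.D] in
theorem inner_sub_fix (u : V) (k : Fin n) (hk : k ∈ K) :
    ⟪u - ∑ k : K, ⟪u, S.α k⟫ • S.ω k, S.α k⟫ = 0 := by
  rw [inner_sub_left, sum_inner, Finset.sum_eq_single ⟨k, hk⟩]
  · simp [inner_smul_left, S.dual]
  · intro j _ hj
    rw [inner_smul_left, S.dual, if_neg, mul_zero]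
    intro h
    exact hj (Subtype.ext h)
  · simp

theorem fold_mem_ideal {q : MvPolynomial κ ℝ} (hq : q ∈ S.idealQ e) :
    S.fold e q ∈ S.ideal := by
  have : S.idealQ e ≤ S.ideal.comap (S.fold e) := by
    refine Ideal.span_le.2 ?_
    rintro _ ((⟨T, hT, rfl⟩ | ⟨F, k, h, rfl⟩) | ⟨u, rfl⟩)
    · simp only [SetLike.mem_coe, Ideal.mem_comap, map_prod, fold_inl]
      refine S.sr_le ?_
      have := S.prod_Z_mem_sr (T.map (Function.Embedding.subtype _)) (by simp +contextual) hT
      simpa using this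
    · simp only [SetLike.mem_coe, Ideal.mem_comap, map_mul, fold_inl,
        fold_inr]
      have := Ideal.mul_mem_left S.ideal (C ‖S.α k‖) (S.θ_mul_Z_mem F.2 k.2 h)
      convert this using 1
      ring
    · have hu := S.θ_eq_lin (u - ∑ k : K, ⟪u, S.α k⟫ • S.ω k) (S.inner_sub_fix u)
      have hs : S.θ u = S.θ (u - ∑ k : K, ⟪u, S.α k⟫ • S.ω k) +
          ∑ k : K, C ⟪u, S.α k⟫ * S.θ (S.ω k) := by
        have hsum : S.θ (∑ k : K, ⟪u, S.α k⟫ • S.ω k) =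
            ∑ k : K, C ⟪u, S.α k⟫ * S.θ (S.ω k) := by
          simp only [← θ_smul]
          refine map_sum (⟨⟨S.θ, ?_⟩, S.θ_add⟩ : V →+ MvPolynomial ι ℝ) _ _
          simpa using S.θ_smul 0 0
        rw [← hsum, ← S.θ_add, sub_add_cancel]
      have : S.fold e (S.linQ e u) = S.lin (u - ∑ k : K, ⟪u, S.α k⟫ • S.ω k) := by
        have hC (c : ℝ) : S.fold e (C c) = C c := by simp [fold]
        rw [← hu, eq_sub_of_add_eq hs.symm, S.θ_eq_sum_Z u]
        simp only [linQ, map_sub, map_sum, map_mul, fold_inl, fold_inr, hC]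
        congr 1
        refine Finset.sum_congr rfl fun k _ => ?_
        rw [← mul_assoc, ← C_mul, ← C_mul, inv_mul_cancel_right₀ (norm_ne_zero_iff.2 (S.α_ne k))]
      show S.fold e (S.linQ e u) ∈ S.ideal
      rw [this]
      exact S.linI_le (Ideal.subset_span ⟨_, rfl⟩)
  exact this hq

open Classical in
/-- Restriction to the fundamental domain, with values on the quotient side. -/
def resQ : MvPolynomial ι ℝ →ₐ[ℝ] MvPolynomial κ ℝ :=
  aeval fun F => if h : F ∈ S.D then X (e (.inl ⟨F, h⟩)) else 0

omit [Fintype ι] [Fintype K] [Fintype S.D] in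
theorem resQ_X (F : S.D) : S.resQ e (X F) = X (e (.inl F)) := by simp [resQ]

omit [Fintype ι] [Fintype K] [Fintype S.D] in
theorem resQ_X_of_notMem {F : ι} (h : F ∉ S.D) : S.resQ e (X F) = 0 := by simp [resQ, h]

omit [Fintype ι] [Fintype K] [Fintype S.D] in
@[simp] theorem resQ_C (c : ℝ) : S.resQ e (C c) = C c := by simp [resQ]

omit [Fintype K] [Fintype S.D] in
/-- Every invariant polynomial is folded from its restriction, modulo the Stanley–Reisner ideal. -/
theorem sub_fold_resQ_mem (p : MvPolynomial ι ℝ) (hp : ∀ g : G, act G g p = p) :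
    p - S.fold e (S.resQ e p) ∈ S.sr := by
  refine S.mem_sr_of_invariant _ (fun g => by simp [hp]) fun a ha => ?_
  have : (S.res.comp ((S.fold e).comp (S.resQ e))) = S.res := by
    refine MvPolynomial.algHom_ext fun F => ?_
    by_cases hF : F ∈ S.D
    · have := S.resQ_X e ⟨F, hF⟩
      simp only at this
      simp only [AlgHom.comp_apply, this, fold_inl, res_X, if_pos hF]
      rw [S.res_Z hF]
    · simp [S.resQ_X_of_notMem e hF, res_X, hF]
  have h2 := DFunLike.congr_fun this p
  simp only [AlgHom.comp_apply] at h2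
  simp [h2] at ha

omit [Fintype K] [Fintype S.D] in
theorem resQ_Z (F : S.D) : S.resQ e (S.Z F) = X (e (.inl F)) := by
  simp only [Z, map_sum]
  rw [Finset.sum_eq_single (F : ι)]
  · rw [if_pos (S.dom_of_mem F.2), resQ_X]
  · intro H _ hH
    split_ifs with h
    · exact S.resQ_X_of_notMem e fun hD => hH ((S.dom_of_mem hD).symm.trans h)
    · simp
  · simp

omit [Fintype K] in
theorem resQ_θ (u : V) : S.resQ e (S.θ u) = ∑ F : S.D, C ⟪u, S.ℓ F⟫ * X (e (.inl F)) := by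
  simp [S.θ_eq_sum_Z, resQ_Z]

omit [Fintype ι] in
theorem linQ_mem (u : V) : S.linQ e u ∈ S.idealQ e :=
  Ideal.subset_span (Or.inr ⟨u, rfl⟩)

theorem resQ_θ_of_notMem {i : Fin n} (hi : i ∉ K) : S.resQ e (S.θ (S.ω i)) ∈ S.idealQ e := by
  convert S.linQ_mem e (S.ω i) using 1
  rw [resQ_θ, linQ, eq_comm, sub_eq_self]
  refine Finset.sum_eq_zero fun k _ => ?_
  rw [S.dual, if_neg]
  · simp
  · rintro rfl
    exact hi k.2

theorem resQ_θ_sub_mem (k : K) :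
    S.resQ e (S.θ (S.ω k)) - C ‖S.α k‖⁻¹ * X (e (.inr k)) ∈ S.idealQ e := by
  convert S.linQ_mem e (S.ω k) using 1
  rw [resQ_θ, linQ]
  congr 1
  rw [Finset.sum_eq_single k]
  · simp [S.dual]
  · intro j _ hj
    rw [S.dual, if_neg]
    · simp
    · intro h
      exact hj (Subtype.ext h.symm)
  · simp

theorem resQ_fold_sub_mem (q : MvPolynomial κ ℝ) :
    S.resQ e (S.fold e q) - q ∈ S.idealQ e := by
  have : ((Ideal.Quotient.mkₐ ℝ (S.idealQ e)).comp ((S.resQ e).comp (S.fold e))) =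
      Ideal.Quotient.mkₐ ℝ (S.idealQ e) := by
    refine MvPolynomial.algHom_ext fun c => ?_
    simp only [AlgHom.comp_apply, Ideal.Quotient.mkₐ_eq_mk]
    rw [Ideal.Quotient.eq]
    obtain ⟨c | k, rfl⟩ := e.surjective c
    · simp [resQ_Z]
    · convert Ideal.mul_mem_left _ (C ‖S.α k‖) (S.resQ_θ_sub_mem e k) using 1
      rw [fold_inr, map_mul, resQ_C, mul_sub, ← mul_assoc (C _) (C _), ← C_mul, mul_inv_cancel₀,
        C_1, one_mul]
      exact norm_ne_zero_iff.2 (S.α_ne k)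
  have h := DFunLike.congr_fun this q
  simp only [AlgHom.comp_apply, Ideal.Quotient.mkₐ_eq_mk] at h
  rwa [Ideal.Quotient.eq] at h

omit [Fintype ι] in
theorem resQ_sr {p : MvPolynomial ι ℝ} (hp : p ∈ S.sr) : S.resQ e p ∈ S.idealQ e := by
  classical
  have : S.sr ≤ (S.idealQ e).comap (S.resQ e) := by
    refine Ideal.span_le.2 ?_
    rintro _ ⟨t, ht, rfl⟩
    simp only [SetLike.mem_coe, Ideal.mem_comap, map_prod]
    by_cases h : ∀ F ∈ t, F ∈ S.D
    · refine Ideal.subset_span (Or.inl (Or.inl ⟨t.subtype (· ∈ S.D), ?_, ?_⟩))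
      · rwa [show Function.Embedding.subtype (· ∈ S.D) = Function.Embedding.subtype _ from rfl,
          Finset.subtype_map_of_mem h]
      · rw [← Finset.prod_subtype_of_mem (p := (· ∈ S.D)) (fun F => S.resQ e (X F)) h]
        exact Finset.prod_congr rfl fun F _ => S.resQ_X e F
    · push Not at h
      obtain ⟨F, hF, hD⟩ := h
      rw [Finset.prod_eq_zero hF (S.resQ_X_of_notMem e hD)]
      exact Ideal.zero_mem _
  exact this hp

variable [Fintype G]

/-- Sum over the group followed by restriction to the fundamental domain. -/
def avg : MvPolynomial ι ℝ →ₗ[ℝ] MvPolynomial κ ℝ :=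
  ∑ g : G, (S.resQ e).toLinearMap ∘ₗ (act G g).toLinearMap

omit [Fintype ι] [Fintype K] [Fintype S.D] in
theorem avg_apply (p : MvPolynomial ι ℝ) : S.avg e p = ∑ g : G, S.resQ e (act G g p) := by
  simp [avg]

omit [Fintype ι] [Fintype K] [Fintype S.D] in
theorem avg_act (h : G) (p : MvPolynomial ι ℝ) : S.avg e (act G h p) = S.avg e p := by
  simp only [avg_apply, act_act]
  exact Fintype.sum_equiv (Equiv.mulRight h) _ _ fun g => rfl

omit [Fintype ι] in
theorem avg_sr {p : MvPolynomial ι ℝ} (hp : p ∈ S.sr) : S.avg e p ∈ S.idealQ e := by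
  rw [avg_apply]
  exact Ideal.sum_mem _ fun g _ => S.resQ_sr e (S.act_sr g hp)

omit [Fintype ι] [Fintype K] [Fintype S.D] in
theorem avg_mul_of_invariant {t : MvPolynomial ι ℝ} (ht : ∀ g : G, act G g t = t)
    (p : MvPolynomial ι ℝ) : S.avg e (t * p) = S.resQ e t * S.avg e p := by
  simp [avg_apply, ht, Finset.mul_sum]

theorem avg_θ_mul_mem {F : ι} (hF : F ∈ S.D) (k : K) (h : ⟪S.ℓ F, S.α k⟫ ≠ 0)
    (p : MvPolynomial ι ℝ) : S.avg e (S.θ (S.ω k) * (X F * p)) ∈ S.idealQ e := by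
  rw [S.avg_mul_of_invariant e (fun g => S.act_θ g _), avg_apply, Finset.mul_sum]
  refine Ideal.sum_mem _ fun g _ => ?_
  rw [map_mul, act_X, map_mul, ← mul_assoc]
  refine Ideal.mul_mem_right _ _ ?_
  by_cases hD : g • F ∈ S.D
  · rw [S.fund g F hF hD, S.resQ_X e ⟨F, hF⟩]
    have h1 := Ideal.mul_mem_right (X (e (.inl ⟨F, hF⟩))) _ (S.resQ_θ_sub_mem e k)
    have h2 : (X (e (.inl ⟨F, hF⟩)) * X (e (.inr k)) : MvPolynomial κ ℝ) ∈ S.idealQ e :=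
      Ideal.subset_span (Or.inl (Or.inr ⟨⟨F, hF⟩, k, h, rfl⟩))
    convert Ideal.add_mem _ h1 (Ideal.mul_mem_left _ (C ‖S.α k‖⁻¹) h2) using 1
    ring
  · rw [S.resQ_X_of_notMem e hD, mul_zero]
    exact Ideal.zero_mem _

theorem avg_lin_ω_mul_monomial_mem (a : ι →₀ ℕ) (c : ℝ) (ha : ∀ F ∈ a.support, F ∈ S.D)
    (i : Fin n) (hi : i ∈ K → ∃ F ∈ a.support, ⟪S.ℓ F, S.α i⟫ ≠ 0) :
    S.avg e (S.lin (S.ω i) * monomial a c) ∈ S.idealQ e := by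
  by_cases hK : i ∈ K
  · obtain ⟨F, hF, h⟩ := hi hK
    have hdvd : (X F : MvPolynomial ι ℝ) ∣ monomial a c := by
      rw [monomial_eq]
      exact Dvd.dvd.mul_left ((dvd_pow_self _ (Finsupp.mem_support_iff.1 hF)).trans
        (Finset.dvd_prod_of_mem (fun E => X E ^ a E) hF)) _
    obtain ⟨p, hp⟩ := hdvd
    rw [hp]
    have h1 := S.avg_sr e (Ideal.mul_mem_right p _ (S.θ_mul_X_sub_mem (ha F hF) hK h))
    convert Ideal.sub_mem _ (S.avg_θ_mul_mem e (ha F hF) ⟨i, hK⟩ h p) h1 using 1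
    rw [← map_sub]
    congr 1
    ring
  · rw [← S.θ_eq_lin, S.avg_mul_of_invariant e (fun g => S.act_θ g _)]
    · exact Ideal.mul_mem_right _ _ (S.resQ_θ_of_notMem e hK)
    · intro k hk
      rw [S.dual, if_neg]
      rintro rfl
      exact hK hk

theorem avg_lin_mul_monomial_mem_of_mem [FiniteDimensional ℝ V] (a : ι →₀ ℕ) (c : ℝ)
    (ha : ∀ F ∈ a.support, F ∈ S.D) (u : V) :
    S.avg e (S.lin u * monomial a c) ∈ S.idealQ e := by
  let J : Set V := {v | ∃ j ∈ K, (∀ F ∈ a.support, ⟪S.ℓ F, S.α j⟫ = 0) ∧ v = S.α j}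
  obtain ⟨y, hy, z, hz, rfl⟩ := Submodule.exists_add_mem_mem_orthogonal (K := Submodule.span ℝ J) u
  rw [S.lin_add, add_mul, map_add]
  have hsmul (r : ℝ) (v : V) (h : S.avg e (S.lin v * monomial a c) ∈ S.idealQ e) :
      S.avg e (S.lin (r • v) * monomial a c) ∈ S.idealQ e := by
    rw [S.lin_smul, mul_assoc, ← smul_eq_C_mul, map_smul, smul_eq_C_mul]
    exact Ideal.mul_mem_left _ _ h
  have hadd (v w : V) (hv : S.avg e (S.lin v * monomial a c) ∈ S.idealQ e)
      (hw : S.avg e (S.lin w * monomial a c) ∈ S.idealQ e) :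
      S.avg e (S.lin (v + w) * monomial a c) ∈ S.idealQ e := by
    rw [S.lin_add, add_mul, map_add]
    exact Ideal.add_mem _ hv hw
  have hzero : S.avg e (S.lin 0 * monomial a c) ∈ S.idealQ e := by simp [lin]
  refine Ideal.add_mem _ ?_ ?_
  · induction hy using Submodule.span_induction with
    | zero => exact hzero
    | add v w _ _ hv hw => exact hadd v w hv hw
    | smul r v _ hv => exact hsmul r v hv
    | mem v hv =>
      obtain ⟨j, hj, hF, rfl⟩ := hv
      obtain ⟨r, hr, hfix⟩ := S.refl j hj
      have hm : act G r (monomial a c) = monomial a c := by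
        rw [monomial_eq]
        simp only [map_mul, act_C, Finsupp.prod, map_prod, map_pow, act_X]
        congr 1
        exact Finset.prod_congr rfl fun F h => by rw [hfix F (ha F h) (hF F h)]
      have h := S.avg_act e r (S.lin (S.α j) * monomial a c)
      rw [map_mul, act_lin, hr, hm, ← neg_one_smul ℝ, S.lin_smul] at h
      simp only [C_1, neg_mul, one_mul, map_neg] at h
      rw [neg_eq_self] at h
      rw [h]
      exact Ideal.zero_mem _
  · rw [S.expand z]
    refine Finset.sum_induction _ (fun v => S.avg e (S.lin v * monomial a c) ∈ S.idealQ e)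
      hadd hzero fun i _ => ?_
    by_cases hzi : ⟪z, S.α i⟫ = 0
    · rw [hzi, zero_smul]
      exact hzero
    · refine hsmul _ _ (S.avg_lin_ω_mul_monomial_mem e a c ha i fun hi => ?_)
      by_contra! hcon
      refine hzi ?_
      rw [real_inner_comm]
      exact hz _ (Submodule.subset_span ⟨i, hi, hcon, rfl⟩)

theorem avg_lin_mul_monomial_mem [FiniteDimensional ℝ V] (a : ι →₀ ℕ) (c : ℝ) (u : V) :
    S.avg e (S.lin u * monomial a c) ∈ S.idealQ e := by
  by_cases hΔ : S.Δ a.support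
  · obtain ⟨g, hg⟩ := S.move _ hΔ
    rw [← S.avg_act e g, map_mul, act_lin, show act G g (monomial a c) =
      monomial (a.mapDomain (g • ·)) c from rename_monomial _ _ _]
    refine S.avg_lin_mul_monomial_mem_of_mem e _ c (fun F hF => ?_) _
    rw [Finsupp.mapDomain_support_of_injective (MulAction.injective g), Finset.mem_image] at hF
    obtain ⟨E, hE, rfl⟩ := hF
    exact hg E hE
  · exact S.avg_sr e (Ideal.mul_mem_left _ _ (S.monomial_mem_sr a c hΔ))

theorem avg_mem [FiniteDimensional ℝ V] {p : MvPolynomial ι ℝ} (hp : p ∈ S.ideal) :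
    S.avg e p ∈ S.idealQ e := by
  obtain ⟨q, hq, r, hr, rfl⟩ := Submodule.mem_sup.1 hp
  rw [map_add]
  refine Ideal.add_mem _ (S.avg_sr e hq) ?_
  suffices h : ∀ s, S.avg e (s * r) ∈ S.idealQ e by simpa using h 1
  clear hq hp q
  induction hr using Submodule.span_induction with
  | zero => simp
  | add x y _ _ hx hy =>
    intro s
    rw [mul_add, map_add]
    exact Ideal.add_mem _ (hx s) (hy s)
  | smul t x _ hx =>
    intro s
    rw [smul_eq_mul, ← mul_assoc]
    exact hx _
  | mem x hx =>
    obtain ⟨u, rfl⟩ := hx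
    intro s
    induction s using MvPolynomial.induction_on' with
    | monomial a c =>
      rw [mul_comm]
      exact S.avg_lin_mul_monomial_mem e a c u
    | add p q hp hq =>
      rw [add_mul, map_add]
      exact Ideal.add_mem _ hp hq

theorem mem_idealQ_of_fold_mem [FiniteDimensional ℝ V] {q : MvPolynomial κ ℝ}
    (h : S.fold e q ∈ S.ideal) : q ∈ S.idealQ e := by
  have h1 := S.avg_mem e h
  rw [avg_apply] at h1
  simp only [act_fold, Finset.sum_const, Finset.card_univ, nsmul_eq_mul] at h1
  have h2 : S.resQ e (S.fold e q) ∈ S.idealQ e := by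
    have h3 := Ideal.mul_mem_left _ (C ((Fintype.card G : ℝ)⁻¹)) h1
    rwa [← mul_assoc, ← C_eq_coe_nat, ← C_mul, inv_mul_cancel₀, C_1, one_mul] at h3
    exact Nat.cast_ne_zero.2 Fintype.card_ne_zero
  rw [← sub_sub_cancel (S.resQ e (S.fold e q)) q]
  exact Ideal.sub_mem _ h2 (S.resQ_fold_sub_mem e q)

omit [Fintype K] [Fintype S.D] in
/-- Every class invariant under the group is the class of a folded polynomial. -/
theorem exists_fold_sub_mem (p : MvPolynomial ι ℝ) (hp : ∀ g : G, act G g p - p ∈ S.ideal) :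
    ∃ q, p - S.fold e q ∈ S.ideal := by
  let s : MvPolynomial ι ℝ := C ((Fintype.card G : ℝ)⁻¹) * ∑ g : G, act G g p
  have hs (g : G) : act G g s = s := by
    simp only [s, map_mul, act_C, map_sum, act_act]
    congr 1
    exact Fintype.sum_equiv (Equiv.mulLeft g) _ _ fun _ => rfl
  have hps : s - p ∈ S.ideal := by
    have h1 : s - p = C ((Fintype.card G : ℝ)⁻¹) * ∑ g : G, (act G g p - p) := by
      rw [Finset.sum_sub_distrib, mul_sub]
      congr 1
      rw [Finset.sum_const, Finset.card_univ, nsmul_eq_mul, ← mul_assoc, ← C_eq_coe_nat, ← C_mul,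
        inv_mul_cancel₀, C_1, one_mul]
      exact Nat.cast_ne_zero.2 Fintype.card_ne_zero
    rw [h1]
    exact Ideal.mul_mem_left _ _ (Ideal.sum_mem _ fun g _ => hp g)
  refine ⟨S.resQ e s, ?_⟩
  convert Ideal.sub_mem _ (S.sr_le (S.sub_fold_resQ_mem e s hs)) hps using 1
  ring

/-- The quotient algebra is the invariant subalgebra. -/
theorem nonempty_algEquiv [FiniteDimensional ℝ V] {I : Ideal (MvPolynomial ι ℝ)}
    (hI : I = S.ideal) {J : Ideal (MvPolynomial κ ℝ)} (hJ : J = S.idealQ e)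
    (B : Subalgebra ℝ (MvPolynomial ι ℝ ⧸ I))
    (hB : ∀ p, Ideal.Quotient.mk I p ∈ B ↔ ∀ g : G, act G g p - p ∈ I) :
    Nonempty ((MvPolynomial κ ℝ ⧸ J) ≃ₐ[ℝ] B) := by
  subst hI hJ
  let φ : (MvPolynomial κ ℝ ⧸ S.idealQ e) →ₐ[ℝ] (MvPolynomial ι ℝ ⧸ S.ideal) :=
    Ideal.quotientMapₐ _ (S.fold e) fun _ h => S.fold_mem_ideal e h
  have hφ (q : MvPolynomial κ ℝ) : φ (Ideal.Quotient.mk _ q) =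
    Ideal.Quotient.mk _ (S.fold e q) := rfl
  have hmem (x : MvPolynomial κ ℝ ⧸ S.idealQ e) : φ x ∈ B := by
    obtain ⟨q, rfl⟩ := Ideal.Quotient.mk_surjective x
    rw [hφ, hB]
    intro g
    simp
  refine ⟨AlgEquiv.ofBijective (φ.codRestrict B hmem) ⟨?_, ?_⟩⟩
  · rw [injective_iff_map_eq_zero]
    intro x hx
    obtain ⟨q, rfl⟩ := Ideal.Quotient.mk_surjective x
    have h1 : φ (Ideal.Quotient.mk _ q) = 0 := congrArg Subtype.val hx
    rw [hφ, Ideal.Quotient.eq_zero_iff_mem] at h1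
    exact Ideal.Quotient.eq_zero_iff_mem.2 (S.mem_idealQ_of_fold_mem e h1)
  · rintro ⟨y, hy⟩
    obtain ⟨p, rfl⟩ := Ideal.Quotient.mk_surjective y
    obtain ⟨q, hq⟩ := S.exists_fold_sub_mem e p ((hB p).1 hy)
    exact ⟨Ideal.Quotient.mk _ q, Subtype.ext ((Ideal.Quotient.eq.2 hq).symm)⟩

end Quotient
end FoldData
end FoldData
/-! ### Facets and outward normals -/

section Polytopes

open Filter Topology

theorem vectorSpan_le_orthogonal {F : Set V} {u : V} {c : ℝ} (h : ∀ x ∈ F, ⟪u, x⟫ = c) :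
    vectorSpan ℝ F ≤ (ℝ ∙ u)ᗮ := by
  refine Submodule.span_le.2 ?_
  rintro _ ⟨x, hx, y, hy, rfl⟩
  rw [SetLike.mem_coe, Submodule.mem_orthogonal_singleton_iff_inner_right]
  simp [inner_sub_right, h x hx, h y hy]

theorem finrank_orthogonal_add_one [FiniteDimensional ℝ V] {u : V} (hu : u ≠ 0) :
    Module.finrank ℝ (ℝ ∙ u)ᗮ + 1 = Module.finrank ℝ V := by
  rw [← Submodule.finrank_add_finrank_orthogonal (ℝ ∙ u), finrank_span_singleton hu, add_comm]

namespace IsOutwardNormal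

variable {Q F : Set V} {u : V}

theorem ne_zero (h : IsOutwardNormal Q F u) : u ≠ 0 := by
  rintro rfl
  simpa using h.1

theorem vectorSpan_le (h : IsOutwardNormal Q F u) : vectorSpan ℝ F ≤ (ℝ ∙ u)ᗮ := by
  rcases F.eq_empty_or_nonempty with rfl | ⟨x, hx⟩
  · simp
  · refine vectorSpan_le_orthogonal (c := ⟪u, x⟫) fun y hy => ?_
    rw [h.2] at hx hy
    exact le_antisymm (hx.2 y hy.1) (hy.2 x hx.1)

theorem isExposed (h : IsOutwardNormal Q F u) : IsExposed ℝ Q F :=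
  fun _ => ⟨innerSL ℝ u, h.2⟩

theorem isFacet_iff [FiniteDimensional ℝ V] (h : IsOutwardNormal Q F u) :
    IsFacet Q F ↔ vectorSpan ℝ F = (ℝ ∙ u)ᗮ := by
  have h1 := finrank_orthogonal_add_one h.ne_zero
  rw [IsFacet, direction_affineSpan]
  constructor
  · rintro ⟨-, h2⟩
    exact Submodule.eq_of_le_of_finrank_eq h.vectorSpan_le (by omega)
  · intro h2
    exact ⟨h.isExposed, by rw [h2, h1]⟩

theorem nonempty (h : IsOutwardNormal Q F u) (hQ : IsCompact Q) (hne : Q.Nonempty) :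
    F.Nonempty := by
  obtain ⟨x, hx, hmax⟩ := hQ.exists_isMaxOn hne
    (f := fun x => ⟪u, x⟫) (by fun_prop)
  refine ⟨x, ?_⟩
  rw [h.2]
  exact ⟨hx, fun y hy => hmax hy⟩

end IsOutwardNormal

namespace IsFacet

variable {Q F : Set V}

theorem ne (h : IsFacet Q F) (hQ : (interior Q).Nonempty) : F ≠ Q := by
  rintro rfl
  have h1 : affineSpan ℝ F = ⊤ := by
    rw [eq_top_iff, ← isOpen_interior.affineSpan_eq_top hQ]
    exact affineSpan_mono ℝ interior_subset
  have h2 := h.2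
  rw [h1, AffineSubspace.direction_top, finrank_top] at h2
  omega

variable [FiniteDimensional ℝ V]

theorem exists_normal (h : IsFacet Q F) (hQ : (interior Q).Nonempty) (hF : F.Nonempty) :
    ∃ u, IsOutwardNormal Q F u := by
  obtain ⟨l, hl⟩ := h.1 hF
  obtain ⟨u, rfl⟩ := (InnerProductSpace.toDual ℝ V).surjective l
  simp only [InnerProductSpace.toDual_apply_apply] at hl
  have hu : u ≠ 0 := by
    rintro rfl
    exact h.ne hQ (by simpa using hl)
  have hpos : 0 < ‖u‖⁻¹ := inv_pos.2 (norm_pos_iff.2 hu)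
  refine ⟨‖u‖⁻¹ • u, by simp [norm_smul, hu], ?_⟩
  rw [hl]
  ext x
  simp only [inner_smul_left, Set.mem_ofPred_eq, RCLike.conj_to_real, mul_le_mul_iff_right₀ hpos]

theorem normal_unique (h : IsFacet Q F) (hQ : (interior Q).Nonempty) (hF : F.Nonempty)
    {u v : V} (hu : IsOutwardNormal Q F u) (hv : IsOutwardNormal Q F v) : u = v := by
  have h1 : (ℝ ∙ u) = ℝ ∙ v := by
    rw [← Submodule.orthogonal_orthogonal (ℝ ∙ u), ← Submodule.orthogonal_orthogonal (ℝ ∙ v),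
      ← hu.isFacet_iff.1 h, ← hv.isFacet_iff.1 h]
  obtain ⟨c, rfl⟩ := Submodule.mem_span_singleton.1
    (h1 ▸ Submodule.mem_span_singleton_self u : u ∈ ℝ ∙ v)
  have hc : |c| = 1 := by
    have := hu.1
    rwa [norm_smul, hv.1, mul_one] at this
  rcases (abs_eq zero_le_one).1 hc with rfl | rfl
  · simp
  · exfalso
    refine h.ne hQ (hu.2.trans_subset (Set.sep_subset _ _) |>.antisymm fun x hx => ?_)
    obtain ⟨y, hy⟩ := hF
    have hy1 := hy
    rw [hu.2] at hy
    rw [hv.2] at hy1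
    rw [hv.2]
    refine ⟨hx, fun z hz => (hy1.2 z hz).trans ?_⟩
    have := hy.2 x hx
    simpa using this

theorem normalVec_eq (h : IsFacet Q F) (hQ : (interior Q).Nonempty) (hF : F.Nonempty)
    {u : V} (hu : IsOutwardNormal Q F u) : normalVec Q F = u := by
  have hex : ∃ u, IsOutwardNormal Q F u := ⟨u, hu⟩
  rw [normalVec, dif_pos hex]
  exact h.normal_unique hQ hF hex.choose_spec hu

theorem normalVec_spec (h : IsFacet Q F) (hQ : (interior Q).Nonempty) (hF : F.Nonempty) :
    IsOutwardNormal Q F (normalVec Q F) := by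
  obtain ⟨u, hu⟩ := h.exists_normal hQ hF
  rwa [h.normalVec_eq hQ hF hu]

end IsFacet

theorem normalVec_empty {Q : Set V} (hQ : IsCompact Q) (hne : Q.Nonempty) :
    normalVec Q ∅ = 0 := by
  rw [normalVec, dif_neg]
  rintro ⟨u, hu⟩
  exact Set.not_nonempty_empty (hu.nonempty hQ hne)

section Isometry

variable {Q F : Set V} (g : V ≃ₗᵢ[ℝ] V)

theorem IsOutwardNormal.map (hg : g '' Q = Q) {u : V} (h : IsOutwardNormal Q F u) :
    IsOutwardNormal Q (g '' F) (g u) := by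
  have hmem (x : V) : g x ∈ Q ↔ x ∈ Q := by
    conv_lhs => rw [← hg]
    exact g.injective.mem_set_image
  refine ⟨by simp [h.1], ?_⟩
  ext x
  obtain ⟨x, rfl⟩ := g.surjective x
  rw [g.injective.mem_set_image, h.2]
  simp only [Set.mem_ofPred_eq, hmem, LinearIsometryEquiv.inner_map_map, and_congr_right_iff]
  intro _
  constructor
  · intro hx y hy
    obtain ⟨y, rfl⟩ := g.surjective y
    simpa using hx y ((hmem y).1 hy)
  · intro hx y hy
    simpa using hx (g y) ((hmem y).2 hy)

theorem vectorSpan_image_eq : vectorSpan ℝ (g '' F) =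
    (vectorSpan ℝ F).map (g.toLinearEquiv : V →ₗ[ℝ] V) := by
  have := AffineMap.map_vectorSpan
    (g.toLinearEquiv : V →ₗ[ℝ] V).toAffineMap (s := F)
  simpa using this.symm

variable [FiniteDimensional ℝ V]

theorem IsFacet.map (hQ : (interior Q).Nonempty) (hg : g '' Q = Q) (h : IsFacet Q F) :
    IsFacet Q (g '' F) := by
  refine ⟨?_, ?_⟩
  · rintro hne
    have hF : F.Nonempty := by simpa using hne
    exact ((h.normalVec_spec hQ hF).map g hg).isExposed hne
  · have := h.2
    rw [direction_affineSpan] at this ⊢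
    rwa [vectorSpan_image_eq, LinearEquiv.finrank_map_eq]

theorem IsFacet.normalVec_map (hQ : (interior Q).Nonempty) (hc : IsCompact Q) (hg : g '' Q = Q)
    (h : IsFacet Q F) : normalVec Q (g '' F) = g (normalVec Q F) := by
  rcases F.eq_empty_or_nonempty with rfl | hF
  · rw [Set.image_empty, normalVec_empty hc (hQ.mono interior_subset), map_zero]
  · exact (h.map g hQ hg).normalVec_eq hQ (hF.image g) ((h.normalVec_spec hQ hF).map g hg)

end Isometry

theorem IsExposed.eq_closure_convexHull [FiniteDimensional ℝ V] {Q F : Set V} (hc : IsCompact Q)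
    (hQ : Convex ℝ Q) (h : IsExposed ℝ Q F) :
    F = closure (convexHull ℝ (F ∩ Set.extremePoints ℝ Q)) := by
  rw [← h.isExtreme.extremePoints_eq]
  exact (closure_convexHull_extremePoints (h.isCompact hc) (h.convex hQ)).symm

theorem finite_facets [FiniteDimensional ℝ V] {B : Set V} (hB : B.Finite) :
    Finite (Facets (convexHull ℝ B)) := by
  have hc : IsCompact (convexHull ℝ B) := hB.isCompact_convexHull ℝ
  have hinj : Function.Injective fun F : Facets (convexHull ℝ B) =>
      (⟨F.1 ∩ Set.extremePoints ℝ (convexHull ℝ B),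
        Set.inter_subset_right.trans extremePoints_convexHull_subset⟩ : {A : Set V | A ⊆ B}) := by
    intro F H h
    replace h := congrArg Subtype.val h
    dsimp only at h
    refine Subtype.ext ?_
    rw [F.2.1.eq_closure_convexHull hc (convex_convexHull ℝ B),
      H.2.1.eq_closure_convexHull hc (convex_convexHull ℝ B), h]
  have := hB.finite_subsets.to_subtype
  exact Finite.of_injective _ hinj

theorem eventually_smul_add_nonneg {a b : ℝ} (ha : 0 ≤ a) (h : a = 0 → b = 0) :
    ∀ᶠ t : ℝ in 𝓝[>] 0, 0 ≤ a + t * b := by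
  rcases ha.eq_or_lt with rfl | ha
  · simp [h rfl]
  · have : Tendsto (fun t : ℝ => a + t * b) (𝓝[>] 0) (𝓝 (a + 0 * b)) :=
      tendsto_nhdsWithin_of_tendsto_nhds (by
        have : Continuous fun t : ℝ => a + t * b := by fun_prop
        exact this.tendsto 0)
    rw [zero_mul, add_zero] at this
    filter_upwards [this.eventually_const_lt ha] with t ht using ht.le

theorem convex_cham {n : ℕ} (α : Fin n → V) (K : Set (Fin n)) : Convex ℝ (cham α K) := by
  intro x hx y hy a b ha hb _ k hk
  simp only [inner_add_left, inner_smul_left, RCLike.conj_to_real]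
  have := mul_nonneg ha (hx k hk)
  have := mul_nonneg hb (hy k hk)
  linarith

theorem isClosed_cham {n : ℕ} (α : Fin n → V) (K : Set (Fin n)) : IsClosed (cham α K) := by
  have : cham α K = ⋂ k ∈ K, {x : V | 0 ≤ ⟪x, α k⟫} := by ext; simp [cham]
  rw [this]
  exact isClosed_biInter fun k _ => isClosed_le continuous_const (by fun_prop)

theorem finite_extremePoints_inter_cham {B : Set V} (hB : B.Finite) {n : ℕ} (α : Fin n → V)
    (K : Set (Fin n)) : (Set.extremePoints ℝ (convexHull ℝ B ∩ cham α K)).Finite := by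
  classical
  have hex (x : V) (hx : x ∈ Set.extremePoints ℝ (convexHull ℝ B ∩ cham α K)) :
      ∃ w : V → ℝ, (∀ y ∈ B, 0 ≤ w y) ∧ ∑ y ∈ hB.toFinset, w y = 1 ∧
        ∑ y ∈ hB.toFinset, w y • y = x := by
    have h := hx.1.1
    rw [hB.convexHull_eq] at h
    obtain ⟨w, h0, h1, h2⟩ := h
    refine ⟨w, h0, h1, ?_⟩
    rwa [Finset.centerMass_eq_of_sum_1 _ _ h1] at h2
  choose! w hw0 hw1 hw2 using hex
  let f : V → Set V × Set (Fin n) := fun x => ({b ∈ B | w x b = 0}, {k | ⟪x, α k⟫ = 0})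
  refine Set.Finite.of_finite_image (f := f) ?_ ?_
  · refine (hB.finite_subsets.prod (Set.toFinite Set.univ)).subset ?_
    rintro _ ⟨x, -, rfl⟩
    exact ⟨Set.sep_subset _ _, Set.mem_univ _⟩
  · intro x hx y hy hxy
    simp only [f, Prod.mk.injEq] at hxy
    have hxw (b : V) (hb : b ∈ B) (h : w x b = 0) : w y b = 0 :=
      ((Set.ext_iff.1 hxy.1 b).1 ⟨hb, h⟩).2
    have hxα (k : Fin n) (h : ⟪x, α k⟫ = 0) : ⟪y, α k⟫ = 0 := (Set.ext_iff.1 hxy.2 k).1 h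
    have e1 : ∀ᶠ t : ℝ in 𝓝[>] 0, ∀ b ∈ B, 0 ≤ w x b + t * (w x b - w y b) :=
      hB.eventually_all.2 fun b hb => eventually_smul_add_nonneg (hw0 x hx b hb)
        fun h => by rw [h, hxw b hb h, sub_zero]
    have e2 : ∀ᶠ t : ℝ in 𝓝[>] 0, ∀ k ∈ K, 0 ≤ ⟪x, α k⟫ + t * (⟪x, α k⟫ - ⟪y, α k⟫) :=
      (Set.toFinite K).eventually_all.2 fun k hk => eventually_smul_add_nonneg (hx.1.2 k hk)
        fun h => by rw [h, hxα k h, sub_zero]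
    obtain ⟨t, ⟨h1, h2⟩, ht⟩ := ((e1.and e2).and self_mem_nhdsWithin).exists
    have ht : 0 < t := ht
    have hz : x + t • (x - y) ∈ convexHull ℝ B ∩ cham α K := by
      refine ⟨?_, fun k hk => ?_⟩
      · rw [hB.convexHull_eq]
        have hs : ∑ b ∈ hB.toFinset, (w x b + t * (w x b - w y b)) = 1 := by
          rw [Finset.sum_add_distrib, ← Finset.mul_sum, Finset.sum_sub_distrib, hw1 x hx, hw1 y hy]
          ring
        refine ⟨fun b => w x b + t * (w x b - w y b), h1, hs, ?_⟩
        rw [Finset.centerMass_eq_of_sum_1 _ _ hs]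
        conv_rhs => rw [← hw2 x hx, ← hw2 y hy]
        simp only [id, add_smul, mul_smul, sub_smul, Finset.sum_add_distrib, Finset.smul_sum,
          ← Finset.sum_sub_distrib]
      · simpa [inner_add_left, inner_smul_left, inner_sub_left] using h2 k hk
    have hzx : x + t • (x - y) = x := by
      refine hx.2 hz hy.1 ⟨1 / (1 + t), t / (1 + t), by positivity, by positivity, by field_simp,
        ?_⟩
      have : 1 + t ≠ 0 := by positivity
      rw [div_eq_inv_mul, div_eq_inv_mul, mul_smul, mul_smul, ← smul_add, inv_smul_eq_iff₀ this]
      module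
    exact sub_eq_zero.1 ((smul_eq_zero.1 (left_eq_add.1 hzx.symm)).resolve_left ht.ne')

theorem exists_finite_inter_cham [FiniteDimensional ℝ V] {B : Set V} (hB : B.Finite) {n : ℕ}
    (α : Fin n → V) (K : Set (Fin n)) :
    ∃ B' : Set V, B'.Finite ∧ convexHull ℝ B ∩ cham α K = convexHull ℝ B' := by
  have hfin := finite_extremePoints_inter_cham hB α K
  refine ⟨_, hfin, ?_⟩
  rw [← (hfin.isClosed_convexHull ℝ).closure_eq]
  exact (closure_convexHull_extremePoints
    ((hB.isCompact_convexHull ℝ).inter_right (isClosed_cham α K))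
    ((convex_convexHull ℝ B).inter (convex_cham α K))).symm

end Polytopes

/-! ### Reflections and parabolic subgroups -/

section Reflections

/-- The reflection `reflMap a` as a linear isometry. -/
def reflIso (a : V) : V ≃ₗᵢ[ℝ] V := (ℝ ∙ a)ᗮ.reflection

theorem reflIso_apply (a x : V) : reflIso a x = x - (2 * ⟪x, a⟫ / ⟪a, a⟫) • a := by
  rw [reflIso, Submodule.reflection_orthogonal_apply, Submodule.reflection_singleton_apply,
    real_inner_self_eq_norm_sq, real_inner_comm, neg_sub, two_smul, ← add_smul]
  congr 2
  simp only [RCLike.ofReal_real_eq_id, id]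
  ring

theorem coe_reflIso (a : V) : ⇑(reflIso a) = reflMap a :=
  funext fun x => reflIso_apply a x

theorem reflIso_self (a : V) : reflIso a a = -a := by
  rcases eq_or_ne a 0 with rfl | ha
  · simp
  · have : ⟪a, a⟫ ≠ 0 := inner_self_ne_zero.2 ha
    rw [reflIso_apply, mul_div_assoc, div_self this]
    module

theorem reflIso_mul_self (a : V) : reflIso a * reflIso a = 1 :=
  Submodule.reflection_mul_reflection _

theorem reflIso_inv (a : V) : (reflIso a)⁻¹ = reflIso a :=
  inv_eq_of_mul_eq_one_right (reflIso_mul_self a)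

theorem reflIso_smul {c : ℝ} (hc : c ≠ 0) (a : V) : reflIso (c • a) = reflIso a := by
  have : (ℝ ∙ (c • a)) = ℝ ∙ a := Submodule.span_singleton_smul_eq hc.isUnit a
  ext x
  simp only [reflIso, this]

theorem reflIso_eq_self {a x : V} (h : ⟪x, a⟫ = 0) : reflIso a x = x := by
  simp [reflIso_apply, h]

theorem inner_reflIso (a x : V) : ⟪reflIso a x, a⟫ = -⟪x, a⟫ := by
  rw [← LinearIsometryEquiv.inner_map_map (reflIso a) x a, reflIso_self, inner_neg_right, neg_neg]

theorem inner_eq_zero_of_reflIso_eq_self {a x : V} (h : reflIso a x = x) : ⟪x, a⟫ = 0 := by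
  have := inner_reflIso a x
  rw [h] at this
  linarith

theorem mul_reflIso (g : V ≃ₗᵢ[ℝ] V) (a : V) : g * reflIso a = reflIso (g a) * g := by
  ext x
  simp [LinearIsometryEquiv.coe_mul, reflIso_apply]

end Reflections

namespace RootSystemData

variable {n : ℕ} (S : RootSystemData V n)

/-- The basis of simple roots. -/
def basis : Module.Basis (Fin n) ℝ V := Module.Basis.mk S.hα_indep S.hα_span.ge

theorem basis_apply (i : Fin n) : S.basis i = S.α i := by simp [basis]

/-- The parabolic subgroup generated by the simple reflections indexed by `K`. -/
def parabolic (K : Set (Fin n)) : Subgroup (V ≃ₗᵢ[ℝ] V) :=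
  Subgroup.closure ((fun k => reflIso (S.α k)) '' K)

variable {S} {K : Set (Fin n)}

theorem reflIso_mem {k : Fin n} (hk : k ∈ K) : reflIso (S.α k) ∈ S.parabolic K :=
  Subgroup.subset_closure ⟨k, hk, rfl⟩

theorem parabolic_mono {K' : Set (Fin n)} (h : K ⊆ K') : S.parabolic K ≤ S.parabolic K' :=
  Subgroup.closure_mono (Set.image_mono h)

theorem mem_WK {s : Function.End V} : s ∈ WK S.α K ↔ ∃ g ∈ S.parabolic K, ⇑g = s := by
  let φ : (V ≃ₗᵢ[ℝ] V) →* Function.End V :=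
    { toFun := fun g => ⇑g, map_one' := rfl, map_mul' := fun _ _ => rfl }
  have h : WK S.α K = (S.parabolic K).toSubmonoid.map φ := by
    rw [parabolic, Subgroup.closure_toSubmonoid, MonoidHom.map_mclosure, WK]
    congr 1
    ext g
    constructor
    · rintro ⟨k, hk, rfl⟩
      exact ⟨_, Or.inl ⟨k, hk, rfl⟩, coe_reflIso _⟩
    · rintro ⟨_, ⟨k, hk, rfl⟩ | ⟨k, hk, h⟩, rfl⟩
      · exact ⟨k, hk, coe_reflIso _⟩
      · refine ⟨k, hk, ?_⟩
        rw [← coe_reflIso, ← reflIso_inv]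
        dsimp only at h
        rw [h, inv_inv]
        rfl
  rw [h]
  rfl

theorem apply_eq_self {g : V ≃ₗᵢ[ℝ] V} (hg : g ∈ S.parabolic K) {u : V}
    (hu : ∀ k ∈ K, ⟪u, S.α k⟫ = 0) : g u = u := by
  induction hg using Subgroup.closure_induction with
  | mem g hg =>
    obtain ⟨k, hk, rfl⟩ := hg
    exact reflIso_eq_self (hu k hk)
  | one => rfl
  | mul g h _ _ hg hh => rw [LinearIsometryEquiv.coe_mul, Function.comp_apply, hh, hg]
  | inv g _ hg => exact g.symm_apply_eq.2 hg.symm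

theorem apply_mem_R {g : V ≃ₗᵢ[ℝ] V} (hg : g ∈ S.parabolic K) {β : V} (hβ : β ∈ S.R) :
    g β ∈ S.R := by
  suffices h : g '' S.R = S.R by
    rw [← h]
    exact Set.mem_image_of_mem _ hβ
  clear hβ
  induction hg using Subgroup.closure_induction with
  | mem g hg =>
    obtain ⟨k, hk, rfl⟩ := hg
    rw [coe_reflIso]
    exact S.hR_refl _ (S.hα_mem k)
  | one => exact Set.image_id _
  | mul g h _ _ hg hh => rw [LinearIsometryEquiv.coe_mul, Set.image_comp, hh, hg]
  | inv g _ hg =>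
    conv_lhs => rw [← hg]
    rw [← Set.image_comp, ← LinearIsometryEquiv.coe_mul, inv_mul_cancel]
    exact Set.image_id _

instance finite_parabolic : Finite (S.parabolic K) := by
  have := S.hR_fin.to_subtype
  refine Finite.of_injective
    (fun (g : S.parabolic K) (β : S.R) => (⟨g.1 β, apply_mem_R g.2 β.2⟩ : S.R)) ?_
  intro g h hgh
  refine Subtype.ext (LinearIsometryEquiv.toLinearEquiv_injective
    (LinearEquiv.toLinearMap_injective (S.basis.ext fun i => ?_)))
  rw [basis_apply]
  exact congrArg Subtype.val (congrFun hgh ⟨S.α i, S.hα_mem i⟩)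

variable (S) in
/-- The product of simple reflections along a word. -/
def word (L : List (Fin n)) : V ≃ₗᵢ[ℝ] V := (L.map fun k => reflIso (S.α k)).prod

theorem word_cons (i : Fin n) (L : List (Fin n)) :
    S.word (i :: L) = reflIso (S.α i) * S.word L := by simp [word]

theorem word_append (L L' : List (Fin n)) : S.word (L ++ L') = S.word L * S.word L' := by
  simp [word]

theorem word_mem {L : List (Fin n)} (hL : ∀ i ∈ L, i ∈ K) : S.word L ∈ S.parabolic K := by
  refine Subgroup.list_prod_mem _ fun g hg => ?_
  obtain ⟨i, hi, rfl⟩ := List.mem_map.1 hg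
  exact reflIso_mem (hL i hi)

theorem exists_word {g : V ≃ₗᵢ[ℝ] V} (hg : g ∈ S.parabolic K) :
    ∃ L : List (Fin n), (∀ i ∈ L, i ∈ K) ∧ S.word L = g := by
  induction hg using Subgroup.closure_induction with
  | mem g hg =>
    obtain ⟨k, hk, rfl⟩ := hg
    exact ⟨[k], by simpa using hk, by simp [word]⟩
  | one => exact ⟨[], by simp, rfl⟩
  | mul g h _ _ hg hh =>
    obtain ⟨L, hL, rfl⟩ := hg
    obtain ⟨L', hL', rfl⟩ := hh
    exact ⟨L ++ L', fun i hi => (List.mem_append.1 hi).elim (hL i) (hL' i), word_append L L'⟩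
  | inv g _ hg =>
    obtain ⟨L, hL, rfl⟩ := hg
    refine ⟨L.reverse, fun i hi => hL i (List.mem_reverse.1 hi), ?_⟩
    rw [word, word, List.prod_inv_reverse, List.map_reverse, List.map_map]
    congr 3

variable [FiniteDimensional ℝ V]

variable (S) in
/-- The basis dual to the simple roots. -/
def fund (i : Fin n) : V :=
  (InnerProductSpace.toDual ℝ V).symm (S.basis.coord i).toContinuousLinearMap

theorem inner_fund (i : Fin n) (x : V) : ⟪S.fund i, x⟫ = S.basis.repr x i := by
  simp [fund]

theorem inner_fund_α (i j : Fin n) : ⟪S.fund i, S.α j⟫ = if i = j then 1 else 0 := by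
  rw [inner_fund, ← basis_apply, Module.Basis.repr_self, Finsupp.single_apply]
  simp [eq_comm]

theorem sum_inner_fund_smul (x : V) : ∑ i, ⟪S.fund i, x⟫ • S.α i = x := by
  simpa [inner_fund, basis_apply] using S.basis.sum_repr x

theorem inner_eq_sum (x y : V) : ⟪x, y⟫ = ∑ i, ⟪S.fund i, y⟫ * ⟪x, S.α i⟫ := by
  conv_lhs => rw [← S.sum_inner_fund_smul y]
  simp [inner_sum, inner_smul_right]

theorem expand_fund (u : V) : u = ∑ i, ⟪u, S.α i⟫ • S.fund i := by
  refine InnerProductSpace.ext_inner_right_basis S.basis fun j => ?_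
  simp [basis_apply, sum_inner, inner_smul_left, inner_fund_α]

theorem pos_or_neg {β : V} (hβ : β ∈ S.R) :
    (∀ i, 0 ≤ ⟪S.fund i, β⟫) ∨ ∀ i, ⟪S.fund i, β⟫ ≤ 0 := by
  obtain ⟨c, rfl, h⟩ := S.hα_sign β hβ
  simpa [inner_sum, inner_smul_right, inner_fund_α] using h

theorem inner_fund_reflIso {i j : Fin n} (h : i ≠ j) (x : V) :
    ⟪S.fund i, reflIso (S.α j) x⟫ = ⟪S.fund i, x⟫ := by
  simp [reflIso_apply, inner_sub_right, inner_smul_right, inner_fund_α, h]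

theorem inner_α_nonpos {i j : Fin n} (h : i ≠ j) : ⟪S.α i, S.α j⟫ ≤ 0 := by
  have hmem : reflIso (S.α j) (S.α i) ∈ S.R :=
    apply_mem_R (K := Set.univ) (reflIso_mem (Set.mem_univ j)) (S.hα_mem i)
  have hj : 0 < ⟪S.α j, S.α j⟫ := real_inner_self_pos.2 (S.hR_ne0 _ (S.hα_mem j))
  rcases pos_or_neg hmem with h1 | h1
  · have h2 := h1 j
    rw [reflIso_apply, inner_sub_right, inner_smul_right, inner_fund_α, inner_fund_α,
      if_neg h.symm, if_pos rfl] at h2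
    by_contra! h3
    have : 0 < 2 * ⟪S.α i, S.α j⟫ / ⟪S.α j, S.α j⟫ := by positivity
    linarith
  · have h2 := h1 i
    rw [inner_fund_reflIso h, inner_fund_α, if_pos rfl] at h2
    exact absurd h2 (by norm_num)

theorem inner_ne_zero {x : V} (hx : ∀ i, 0 < ⟪x, S.α i⟫) {β : V} (hβ : β ∈ S.R) :
    ⟪x, β⟫ ≠ 0 := by
  intro h
  rw [S.inner_eq_sum] at h
  refine S.hR_ne0 β hβ ?_
  rw [← S.sum_inner_fund_smul β]
  rcases pos_or_neg hβ with h1 | h1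
  · rw [Finset.sum_eq_zero_iff_of_nonneg fun i _ => mul_nonneg (h1 i) (hx i).le] at h
    exact Finset.sum_eq_zero fun i hi => by
      rw [(mul_eq_zero.1 (h i hi)).resolve_right (hx i).ne', zero_smul]
  · rw [Finset.sum_eq_zero_iff_of_nonpos fun i _ => mul_nonpos_of_nonpos_of_nonneg (h1 i) (hx i).le]
      at h
    exact Finset.sum_eq_zero fun i hi => by
      rw [(mul_eq_zero.1 (h i hi)).resolve_right (hx i).ne', zero_smul]

variable (S K) in
theorem exists_apply_mem_cham (x : V) : ∃ g ∈ S.parabolic K, g x ∈ cham S.α K := by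
  obtain ⟨g, hg⟩ := Finite.exists_max
    fun g : S.parabolic K => ⟪∑ i, S.fund i, (g : V ≃ₗᵢ[ℝ] V) x⟫
  refine ⟨g, g.2, fun k hk => ?_⟩
  have hk0 : 0 < ⟪S.α k, S.α k⟫ := real_inner_self_pos.2 (S.hR_ne0 _ (S.hα_mem k))
  have h1 := hg (⟨reflIso (S.α k), reflIso_mem hk⟩ * g)
  have h2 : ⟪∑ i, S.fund i, S.α k⟫ = 1 := by simp [sum_inner, inner_fund_α]
  rw [Subgroup.coe_mul, LinearIsometryEquiv.coe_mul, Function.comp_apply, reflIso_apply,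
    inner_sub_right, inner_smul_right, h2] at h1
  by_contra! h3
  have : 2 * ⟪(g : V ≃ₗᵢ[ℝ] V) x, S.α k⟫ / ⟪S.α k, S.α k⟫ < 0 :=
    div_neg_of_neg_of_pos (by linarith) hk0
  linarith

theorem exists_word_mul {L : List (Fin n)} (hL : ∀ i ∈ L, i ∈ K) {k : Fin n}
    (h : ∀ i, ⟪S.fund i, S.word L (S.α k)⟫ ≤ 0) :
    ∃ L' : List (Fin n), L'.length + 1 = L.length ∧ (∀ i ∈ L', i ∈ K) ∧
      S.word L' = S.word L * reflIso (S.α k) := by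
  induction L with
  | nil =>
    have := h k
    rw [word, List.map_nil, List.prod_nil, LinearIsometryEquiv.coe_one, id, inner_fund_α,
      if_pos rfl] at this
    exact absurd this (by norm_num)
  | cons i L ih =>
    have hL1 : ∀ j ∈ L, j ∈ K := fun j hj => hL j (List.mem_cons_of_mem _ hj)
    have hR : S.word L (S.α k) ∈ S.R := apply_mem_R (word_mem hL1) (S.hα_mem k)
    rcases pos_or_neg hR with hpos | hneg
    · refine ⟨L, rfl, hL1, ?_⟩
      have hzero : ∀ j ≠ i, ⟪S.fund j, S.word L (S.α k)⟫ = 0 := fun j hj =>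
        le_antisymm (by simpa [word_cons, inner_fund_reflIso hj] using h j) (hpos j)
      have hv : S.word L (S.α k) = ⟪S.fund i, S.word L (S.α k)⟫ • S.α i := by
        conv_lhs => rw [← S.sum_inner_fund_smul (S.word L (S.α k))]
        exact Finset.sum_eq_single i (fun j _ hj => by rw [hzero j hj, zero_smul]) (by simp)
      have hc : ⟪S.fund i, S.word L (S.α k)⟫ ≠ 0 := by
        intro hc
        rw [hc, zero_smul] at hv
        exact S.hR_ne0 _ hR hv
      rw [word_cons, ← reflIso_smul hc, ← hv, ← mul_reflIso, mul_assoc, reflIso_mul_self, mul_one]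
    · obtain ⟨L', h1, h2, h3⟩ := ih hL1 hneg
      refine ⟨i :: L', by simpa using h1, ?_, by rw [word_cons, word_cons, h3, mul_assoc]⟩
      rintro j (_ | ⟨_, hj⟩)
      exacts [hL i List.mem_cons_self, h2 j hj]

theorem word_mem_stabilizer {L : List (Fin n)} (hL : ∀ i ∈ L, i ∈ K) {x : V}
    (hx : x ∈ cham S.α K) (hwx : S.word L x ∈ cham S.α K) :
    S.word L ∈ S.parabolic {k ∈ K | ⟪x, S.α k⟫ = 0} := by
  induction h : L.length using Nat.strong_induction_on generalizing L with
  | _ N ih =>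
  subst h
  rcases L.eq_nil_or_concat with rfl | ⟨L1, k, rfl⟩
  · exact one_mem _
  rw [List.concat_eq_append] at *
  have hL1 : ∀ i ∈ L1, i ∈ K := fun i hi => hL i (by simp [hi])
  have hk : k ∈ K := hL k (by simp)
  have hw : S.word (L1 ++ [k]) = S.word L1 * reflIso (S.α k) := by simp [word]
  have hmem := word_mem (S := S) hL
  rcases pos_or_neg (apply_mem_R hmem (S.hα_mem k)) with hpos | hneg
  · obtain ⟨L', h1, h2, h3⟩ := exists_word_mul (S := S) hL1 (k := k) fun i => by
      have := hpos i
      rw [hw, LinearIsometryEquiv.coe_mul, Function.comp_apply, reflIso_self, map_neg,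
        inner_neg_right] at this
      linarith
    rw [hw, ← h3] at hwx ⊢
    exact ih _ (by simp; omega) h2 hwx rfl
  · obtain ⟨L', h1, h2, h3⟩ := exists_word_mul hL hneg
    have hcoef : ∀ i ∉ K, ⟪S.fund i, S.word (L1 ++ [k]) (S.α k)⟫ = 0 := fun i hi => by
      have hfix : S.word (L1 ++ [k]) (S.fund i) = S.fund i := apply_eq_self hmem fun j hj => by
        rw [inner_fund_α, if_neg (ne_of_mem_of_not_mem hj hi).symm]
      rw [← hfix, LinearIsometryEquiv.inner_map_map, inner_fund_α,
        if_neg (ne_of_mem_of_not_mem hk hi).symm]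
    have hle : ⟪x, S.α k⟫ ≤ 0 := by
      rw [← LinearIsometryEquiv.inner_map_map (S.word (L1 ++ [k])), S.inner_eq_sum]
      refine Finset.sum_nonpos fun i _ => ?_
      by_cases hi : i ∈ K
      · exact mul_nonpos_of_nonpos_of_nonneg (hneg i) (hwx i hi)
      · rw [hcoef i hi, zero_mul]
    have h0 : ⟪x, S.α k⟫ = 0 := le_antisymm hle (hx k hk)
    have h4 := ih L'.length (by omega) h2 (by
      rwa [h3, LinearIsometryEquiv.coe_mul, Function.comp_apply, reflIso_eq_self h0]) rfl
    rw [h3] at h4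
    exact (Subgroup.mul_mem_cancel_right _ (reflIso_mem (K := {k ∈ K | ⟪x, S.α k⟫ = 0}) ⟨hk, h0⟩)).1 h4

theorem mem_stabilizer {g : V ≃ₗᵢ[ℝ] V} (hg : g ∈ S.parabolic K) {x : V}
    (hx : x ∈ cham S.α K) (hgx : g x ∈ cham S.α K) :
    g ∈ S.parabolic {k ∈ K | ⟪x, S.α k⟫ = 0} := by
  obtain ⟨L, hL, rfl⟩ := exists_word hg
  exact word_mem_stabilizer hL hx hgx

theorem apply_eq_self_of_mem_cham {g : V ≃ₗᵢ[ℝ] V} (hg : g ∈ S.parabolic K) {x : V}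
    (hx : x ∈ cham S.α K) (hgx : g x ∈ cham S.α K) : g x = x :=
  apply_eq_self (mem_stabilizer hg hx hgx) fun _ hk => hk.2

theorem apply_fund_eq_self {g : V ≃ₗᵢ[ℝ] V} (hg : g ∈ S.parabolic K) {x : V}
    (hx : x ∈ cham S.α K) (hgx : g x ∈ cham S.α K) {k : Fin n} (hk : ⟪x, S.α k⟫ ≠ 0) :
    g (S.fund k) = S.fund k :=
  apply_eq_self (mem_stabilizer hg hx hgx) fun j hj => by
    rw [inner_fund_α, if_neg]
    rintro rfl
    exact hk hj.2

end RootSystemData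

/-! ### Facets of the symmetric polytope -/

namespace PermSetup

open Filter Topology

variable {n : ℕ} {S : PermSetup V n} {K : Set (Fin n)}

theorem mem_orbit {x : V} : (x ∈ ⋃ w ∈ WK S.α Set.univ, Set.image w S.Λ) ↔
    ∃ g ∈ S.parabolic Set.univ, ∃ l ∈ S.Λ, g l = x := by
  simp only [Set.mem_iUnion, RootSystemData.mem_WK]
  constructor
  · rintro ⟨_, ⟨g, hg, rfl⟩, l, hl, rfl⟩
    exact ⟨g, hg, l, hl, rfl⟩
  · rintro ⟨g, hg, l, hl, rfl⟩
    exact ⟨_, ⟨g, hg, rfl⟩, l, hl, rfl⟩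

variable (S) in
theorem exists_finite_P : ∃ B : Set V, B.Finite ∧ S.P = convexHull ℝ B := by
  refine ⟨_, ?_, rfl⟩
  refine ((Set.finite_range fun g : S.parabolic Set.univ => (g : V ≃ₗᵢ[ℝ] V)).image2
    (fun g l => g l) S.hΛ_fin).subset ?_
  intro x hx
  obtain ⟨g, hg, l, hl, rfl⟩ := mem_orbit.1 hx
  exact ⟨g, ⟨⟨g, hg⟩, rfl⟩, l, hl, rfl⟩

variable (S) in
theorem isCompact_P : IsCompact S.P := by
  obtain ⟨B, hB, h⟩ := S.exists_finite_P
  rw [h]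
  exact hB.isCompact_convexHull ℝ

variable (S) in
theorem convex_P : Convex ℝ S.P := convex_convexHull ℝ _

theorem image_P {g : V ≃ₗᵢ[ℝ] V} (hg : g ∈ S.parabolic K) : g '' S.P = S.P := by
  have h1 (g : V ≃ₗᵢ[ℝ] V) (hg : g ∈ S.parabolic Set.univ) : g '' S.P ⊆ S.P := by
    rw [PermSetup.P]
    have := (g.toLinearEquiv : V →ₗ[ℝ] V).image_convexHull
      (⋃ w ∈ WK S.α Set.univ, Set.image w S.Λ)
    refine (this.trans_subset (convexHull_mono ?_))
    rintro _ ⟨x, hx, rfl⟩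
    obtain ⟨h, hh, l, hl, rfl⟩ := mem_orbit.1 hx
    exact mem_orbit.2 ⟨g * h, mul_mem hg hh, l, hl, rfl⟩
  have hg := RootSystemData.parabolic_mono (Set.subset_univ K) hg
  refine (h1 g hg).antisymm fun x hx => ⟨g⁻¹ x, h1 _ (inv_mem hg) ⟨x, hx, rfl⟩, ?_⟩
  exact g.apply_symm_apply x

theorem apply_mem_P {g : V ≃ₗᵢ[ℝ] V} (hg : g ∈ S.parabolic K) {x : V} (hx : x ∈ S.P) :
    g x ∈ S.P := by
  rw [← image_P hg]
  exact ⟨x, hx, rfl⟩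

theorem exists_extremePoint (hfull : (interior S.P).Nonempty) {T : Finset (Facets S.P)}
    (hT : (⋂ F ∈ T, F.1).Nonempty) : ∃ v ∈ Set.extremePoints ℝ S.P, ∀ F ∈ T, v ∈ F.1 := by
  have hext : IsExtreme ℝ S.P (S.P ∩ ⋂ F ∈ T, F.1) := by
    refine ⟨Set.inter_subset_left, fun x hx y hy z hz hzxy => ⟨hx, ?_⟩⟩
    refine Set.mem_iInter₂.2 fun F hF => ?_
    exact F.2.1.isExtreme.left_mem_of_mem_openSegment hx hy (Set.mem_iInter₂.1 hz.2 F hF) hzxy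
  have hcomp : IsCompact (S.P ∩ ⋂ F ∈ T, F.1) :=
    S.isCompact_P.inter_right (isClosed_biInter fun F _ => F.2.1.isClosed S.isCompact_P.isClosed)
  have hne : (S.P ∩ ⋂ F ∈ T, F.1).Nonempty := by
    rcases T.eq_empty_or_nonempty with rfl | ⟨F, hF⟩
    · simpa using hfull.mono interior_subset
    · obtain ⟨x, hx⟩ := hT
      exact ⟨x, F.2.1.subset (Set.mem_iInter₂.1 hx F hF), hx⟩
  obtain ⟨v, hv⟩ := hcomp.extremePoints_nonempty hne
  exact ⟨v, hext.extremePoints_subset_extremePoints hv, Set.mem_iInter₂.1 hv.1.2⟩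

/-- A normal maximized at a point of the open chamber lies in the chamber. -/
theorem mem_cham_of_isMax {u x : V} (hx : x ∈ S.P) (hmax : ∀ y ∈ S.P, ⟪u, y⟫ ≤ ⟪u, x⟫)
    (hpos : ∀ k ∈ K, 0 < ⟪x, S.α k⟫) : u ∈ cham S.α K := by
  intro k hk
  have hk0 : 0 < ⟪S.α k, S.α k⟫ := real_inner_self_pos.2 (S.hR_ne0 _ (S.hα_mem k))
  have h := hmax _ (apply_mem_P (RootSystemData.reflIso_mem hk) hx)
  rw [reflIso_apply, inner_sub_right, inner_smul_right] at h
  by_contra! hneg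
  have : 0 < 2 * ⟪x, S.α k⟫ / ⟪S.α k, S.α k⟫ := div_pos (by linarith [hpos k hk]) hk0
  nlinarith

variable [FiniteDimensional ℝ V]

theorem finite_facets_P : Finite (Facets S.P) := by
  obtain ⟨B, hB, h⟩ := S.exists_finite_P
  rw [h]
  exact finite_facets hB

theorem inner_extremePoint_ne_zero (hnd : S.Nondegenerate) {v : V}
    (hv : v ∈ Set.extremePoints ℝ S.P) {β : V} (hβ : β ∈ S.R) : ⟪v, β⟫ ≠ 0 := by
  obtain ⟨g, hg, l, hl, rfl⟩ := mem_orbit.1 (extremePoints_convexHull_subset hv)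
  have h := RootSystemData.inner_ne_zero (hnd l hl)
    (RootSystemData.apply_mem_R (inv_mem hg) hβ)
  rw [← LinearIsometryEquiv.inner_map_map g] at h
  convert h
  exact (g.apply_symm_apply β).symm

theorem zero_mem_interior (hfull : (interior S.P).Nonempty) : 0 ∈ interior S.P := by
  obtain ⟨x, hx⟩ := hfull
  have := Fintype.ofFinite (S.parabolic Set.univ)
  have hmem (g : S.parabolic Set.univ) : (g : V ≃ₗᵢ[ℝ] V) x ∈ interior S.P := by
    have h := (g : V ≃ₗᵢ[ℝ] V).toHomeomorph.image_interior S.P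
    rw [LinearIsometryEquiv.coe_toHomeomorph, image_P g.2] at h
    rw [← h]
    exact ⟨x, hx, rfl⟩
  have hfix (i : Fin n) : ⟪∑ g : S.parabolic Set.univ, (g : V ≃ₗᵢ[ℝ] V) x, S.α i⟫ = 0 := by
    apply inner_eq_zero_of_reflIso_eq_self
    rw [map_sum]
    exact Equiv.sum_comp (Equiv.mulLeft (⟨_, RootSystemData.reflIso_mem (Set.mem_univ i)⟩ :
      S.parabolic Set.univ)) fun g : S.parabolic Set.univ => (g : V ≃ₗᵢ[ℝ] V) x
  have hzero : ∑ g : S.parabolic Set.univ, (g : V ≃ₗᵢ[ℝ] V) x = 0 := by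
    rw [RootSystemData.expand_fund (S := S.toRootSystemData) (∑ g, _)]
    exact Finset.sum_eq_zero fun i _ => by rw [hfix i, zero_smul]
  have h := (S.convex_P.interior).sum_mem (t := Finset.univ)
    (w := fun _ : S.parabolic Set.univ => (Fintype.card (S.parabolic Set.univ) : ℝ)⁻¹)
    (z := fun g => (g : V ≃ₗᵢ[ℝ] V) x) (fun _ _ => by positivity) (by simp) fun g _ => hmem g
  rwa [← Finset.smul_sum, hzero, smul_zero] at h

variable (K) in
/-- The action of a parabolic subgroup on the facets. -/
abbrev facetAction (hfull : (interior S.P).Nonempty) : MulAction (S.parabolic K) (Facets S.P) where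
  smul g F := ⟨(g : V ≃ₗᵢ[ℝ] V) '' F.1, F.2.map _ hfull (image_P g.2)⟩
  one_smul _ := Subtype.ext (Set.image_id _)
  mul_smul g h F := Subtype.ext (Set.image_comp (g : V ≃ₗᵢ[ℝ] V) (h : V ≃ₗᵢ[ℝ] V) F.1)

theorem normalVec_image (hfull : (interior S.P).Nonempty) {g : V ≃ₗᵢ[ℝ] V}
    (hg : g ∈ S.parabolic K) {F : Set V} (hF : IsFacet S.P F) :
    normalVec S.P (g '' F) = g (normalVec S.P F) :=
  hF.normalVec_map g hfull S.isCompact_P (image_P hg)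

theorem image_eq_self (hfull : (interior S.P).Nonempty) {g : V ≃ₗᵢ[ℝ] V}
    (hg : g ∈ S.parabolic K) {F : Set V} (hF : IsFacet S.P F)
    (h1 : normalVec S.P F ∈ cham S.α K) (h2 : normalVec S.P (g '' F) ∈ cham S.α K) :
    g '' F = F := by
  rcases F.eq_empty_or_nonempty with rfl | hne
  · exact Set.image_empty _
  · have h := hF.normalVec_spec hfull hne
    have h' := h.map g (image_P hg)
    rw [normalVec_image hfull hg hF] at h2
    rw [RootSystemData.apply_eq_self_of_mem_cham hg h1 h2] at h'
    rw [h'.2, ← h.2]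

theorem exists_image_mem_cham (hfull : (interior S.P).Nonempty) (hnd : S.Nondegenerate)
    {T : Finset (Facets S.P)} (hT : (⋂ F ∈ T, F.1).Nonempty) :
    ∃ g ∈ S.parabolic K, ∃ x ∈ S.P, (∀ k ∈ K, 0 < ⟪x, S.α k⟫) ∧ ∀ F ∈ T,
      x ∈ g '' F.1 ∧ normalVec S.P (g '' F.1) ∈ cham S.α K := by
  obtain ⟨v, hv, hvT⟩ := exists_extremePoint hfull hT
  obtain ⟨g, hg, hgv⟩ := S.exists_apply_mem_cham K v
  have hpos (k) (hk : k ∈ K) : 0 < ⟪g v, S.α k⟫ := by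
    refine (hgv k hk).lt_of_ne' ?_
    have h := inner_extremePoint_ne_zero hnd hv
      (RootSystemData.apply_mem_R (inv_mem hg) (S.hα_mem k))
    rw [← LinearIsometryEquiv.inner_map_map g] at h
    convert h
    exact (g.apply_symm_apply _).symm
  have hgP := apply_mem_P hg hv.1
  refine ⟨g, hg, g v, hgP, hpos, fun F hF => ⟨⟨v, hvT F hF, rfl⟩, ?_⟩⟩
  have hn := (F.2.map g hfull (image_P hg)).normalVec_spec hfull ⟨g v, v, hvT F hF, rfl⟩
  have hmem : g v ∈ g '' F.1 := ⟨v, hvT F hF, rfl⟩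
  rw [hn.2] at hmem
  exact mem_cham_of_isMax hgP hmem.2 hpos

theorem exists_pos_mem (hfull : (interior S.P).Nonempty) (hnd : S.Nondegenerate)
    {T : Finset (Facets S.P)} (hT : (⋂ F ∈ T, F.1).Nonempty)
    (hTK : ∀ F ∈ T, normalVec S.P F.1 ∈ cham S.α K) :
    ∃ x ∈ S.P, (∀ k ∈ K, 0 < ⟪x, S.α k⟫) ∧ ∀ F ∈ T, x ∈ F.1 := by
  obtain ⟨g, hg, x, hx, hpos, h⟩ := exists_image_mem_cham (K := K) hfull hnd hT
  refine ⟨x, hx, hpos, fun F hF => ?_⟩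
  rw [← image_eq_self hfull hg F.2 (hTK F hF) (h F hF).2]
  exact (h F hF).1

theorem exists_image_mem_cham_single (hfull : (interior S.P).Nonempty) (hnd : S.Nondegenerate)
    {F : Set V} (hF : IsFacet S.P F) :
    ∃ g ∈ S.parabolic K, normalVec S.P (g '' F) ∈ cham S.α K := by
  rcases F.eq_empty_or_nonempty with rfl | hne
  · refine ⟨1, one_mem _, ?_⟩
    rw [Set.image_empty, normalVec_empty S.isCompact_P (hfull.mono interior_subset)]
    exact fun k _ => by simp
  · obtain ⟨g, hg, x, -, -, h⟩ := exists_image_mem_cham (K := K) hfull hnd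
      (T := {⟨F, hF⟩}) (by simpa using hne)
    exact ⟨g, hg, (h ⟨F, hF⟩ (Finset.mem_singleton_self _)).2⟩

variable (S K) in
/-- The facets of `P` whose normal lies in the chamber. -/
def chamFacets : Set (Facets S.P) := {F | normalVec S.P F.1 ∈ cham S.α K}

open Classical in
variable (K) in
/-- The combinatorial data of the facets of `P` with the action of `W_K`. -/
def foldData (hfull : (interior S.P).Nonempty) (hnd : S.Nondegenerate) :
    letI := facetAction K hfull
    FoldData (S.parabolic K) (Facets S.P) K :=
  letI := facetAction K hfull
  have hdom (F : Facets S.P) : ∃ H : Facets S.P, normalVec S.P H.1 ∈ cham S.α K ∧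
      ∃ g : S.parabolic K, H = g • F := by
    obtain ⟨g, hg, h⟩ := exists_image_mem_cham_single (K := K) hfull hnd F.2
    exact ⟨(⟨g, hg⟩ : S.parabolic K) • F, h, _, rfl⟩
  { α := S.α
    ω := S.fund
    ℓ := fun F => normalVec S.P F.1
    Δ := fun T => (⋂ F ∈ T, F.1).Nonempty
    D := S.chamFacets K
    dom := fun F => (hdom F).choose
    α_ne := fun i => S.hR_ne0 _ (S.hα_mem i)
    dual := RootSystemData.inner_fund_α
    expand := RootSystemData.expand_fund
    ℓ_smul := fun g F => normalVec_image hfull g.2 F.2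
    Δ_smul := by
      rintro g T ⟨x, hx⟩
      refine ⟨(g : V ≃ₗᵢ[ℝ] V) x, Set.mem_iInter₂.2 fun H hH => ?_⟩
      obtain ⟨F, hF, rfl⟩ := Finset.mem_image.1 hH
      exact ⟨x, Set.mem_iInter₂.1 hx F hF, rfl⟩
    dom_mem := fun F => (hdom F).choose_spec.1
    dom_orbit := fun F => (hdom F).choose_spec.2
    move := fun T hT => by
      obtain ⟨g, hg, x, -, -, h⟩ := exists_image_mem_cham (K := K) hfull hnd hT
      exact ⟨⟨g, hg⟩, fun F hF => (h F hF).2⟩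
    fund := fun g F h1 h2 => Subtype.ext (image_eq_self hfull g.2 F.2 h1 h2)
    stab := fun g F hF hg k _ hk => by
      refine RootSystemData.apply_fund_eq_self g.2 hF ?_ hk
      rw [← normalVec_image hfull g.2 F.2]
      exact (congrArg (fun H : Facets S.P => normalVec S.P H.1 ∈ cham S.α K) hg).mpr hF
    fix := fun g u hu => RootSystemData.apply_eq_self g.2 hu
    refl := fun k hk => by
      refine ⟨⟨_, RootSystemData.reflIso_mem hk⟩, reflIso_self _, fun F hF h => ?_⟩
      refine Subtype.ext (image_eq_self hfull (RootSystemData.reflIso_mem hk) F.2 hF ?_)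
      rw [normalVec_image hfull (RootSystemData.reflIso_mem hk) F.2, reflIso_eq_self h]
      exact hF }

end PermSetup

/-! ### Facets of the quotient polytope -/

namespace PermSetup

open Filter Topology

theorem exists_pos_of_eventually {p : ℝ → Prop} (h : ∀ᶠ t : ℝ in 𝓝[>] 0, p t) :
    ∃ t : ℝ, 0 < t ∧ p t :=
  (eventually_mem_nhdsWithin.and h).exists

theorem eventually_mem_inter_cham {n : ℕ} {α : Fin n → V} {K : Set (Fin n)} {A : Set V}
    (hA : Convex ℝ A) {x y : V} (hx : x ∈ A) (hy : y ∈ A) (hpos : ∀ k ∈ K, 0 < ⟪x, α k⟫) :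
    ∀ᶠ t : ℝ in 𝓝[>] 0, x + t • (y - x) ∈ A ∩ cham α K := by
  have h : ∀ᶠ t : ℝ in 𝓝[>] 0, ∀ k ∈ K, 0 ≤ ⟪x, α k⟫ + t * ⟪y - x, α k⟫ :=
    (Set.toFinite K).eventually_all.2 fun k hk => eventually_smul_add_nonneg (hpos k hk).le
      fun h => absurd h (hpos k hk).ne'
  filter_upwards [h, Ioo_mem_nhdsGT one_pos] with t h1 h2
  refine ⟨hA.add_smul_sub_mem hx hy (Set.Ioo_subset_Icc_self h2), fun k hk => ?_⟩
  simpa [inner_add_left, inner_smul_left] using h1 k hk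

variable {n : ℕ} {S : PermSetup V n} {K : Set (Fin n)}

variable (S K) in
/-- The quotient polytope `P ∩ C_K`. -/
abbrev quo : Set V := S.P ∩ cham S.α K

variable (S K) in
theorem isCompact_quo : IsCompact (S.quo K) := S.isCompact_P.inter_right (isClosed_cham _ _)

variable (S K) in
/-- The facet of the quotient polytope on the wall orthogonal to `α k`. -/
def wall (k : Fin n) : Set V := {x ∈ S.quo K | ⟪x, S.α k⟫ = 0}

theorem isOutwardNormal_inter_cham {F : Set V} {u x : V} (h : IsOutwardNormal S.P F u) (hx : x ∈ F)
    (hpos : ∀ k ∈ K, 0 < ⟪x, S.α k⟫) : IsOutwardNormal (S.quo K) (F ∩ cham S.α K) u := by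
  refine ⟨h.1, ?_⟩
  have hxF := hx
  rw [h.2] at hx
  ext y
  constructor
  · rintro ⟨hy, hyK⟩
    rw [h.2] at hy
    exact ⟨⟨hy.1, hyK⟩, fun z hz => hy.2 z hz.1⟩
  · rintro ⟨⟨hyP, hyK⟩, hmax⟩
    refine ⟨?_, hyK⟩
    rw [h.2]
    exact ⟨hyP, fun z hz => (hx.2 z hz).trans (hmax x ⟨hx.1, fun k hk => (hpos k hk).le⟩)⟩

theorem exists_pos_of_not_subset_wall {F : Set V} (hF : Convex ℝ F) (hne : F.Nonempty)
    (hFQ : F ⊆ S.quo K) (h : ∀ k ∈ K, ∃ x ∈ F, ⟪x, S.α k⟫ ≠ 0) :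
    ∃ x ∈ F, ∀ k ∈ K, 0 < ⟪x, S.α k⟫ := by
  classical
  suffices H : ∀ s : Finset (Fin n), (∀ k ∈ s, k ∈ K) → ∃ x ∈ F, ∀ k ∈ s, 0 < ⟪x, S.α k⟫ by
    obtain ⟨x, hx, h1⟩ := H (Set.toFinite K).toFinset fun k hk => by simpa using hk
    exact ⟨x, hx, fun k hk => h1 k (by simpa using hk)⟩
  intro s
  induction s using Finset.induction_on with
  | empty =>
    obtain ⟨x, hx⟩ := hne
    exact fun _ => ⟨x, hx, by simp⟩
  | insert a s _ ih =>
    intro hs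
    obtain ⟨x, hx, h1⟩ := ih fun k hk => hs k (Finset.mem_insert_of_mem hk)
    obtain ⟨y, hy, h2⟩ := h a (hs a (Finset.mem_insert_self _ _))
    have h2 : 0 < ⟪y, S.α a⟫ := ((hFQ hy).2 a (hs a (Finset.mem_insert_self _ _))).lt_of_ne' h2
    refine ⟨(1 / 2 : ℝ) • x + (1 / 2 : ℝ) • y,
      hF hx hy (by norm_num) (by norm_num) (by norm_num), fun k hk => ?_⟩
    rw [inner_add_left, inner_smul_left, inner_smul_left]
    simp only [RCLike.conj_to_real]
    have hx0 := (hFQ hx).2 k (hs k hk)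
    have hy0 := (hFQ hy).2 k (hs k hk)
    rcases Finset.mem_insert.1 hk with rfl | hk
    · linarith
    · linarith [h1 k hk]

variable [FiniteDimensional ℝ V]

theorem eventually_smul_mem (hfull : (interior S.P).Nonempty) (y : V) :
    ∀ᶠ t : ℝ in 𝓝[>] 0, t • y ∈ interior S.P := by
  have h : Tendsto (fun t : ℝ => t • y) (𝓝[>] 0) (𝓝 ((0 : ℝ) • y)) :=
    tendsto_nhdsWithin_of_tendsto_nhds (Continuous.tendsto (by fun_prop) 0)
  rw [zero_smul] at h
  exact h (isOpen_interior.mem_nhds (zero_mem_interior hfull))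

theorem exists_smul_mem (hfull : (interior S.P).Nonempty) (y : V) :
    ∃ t : ℝ, 0 < t ∧ t • y ∈ interior S.P :=
  exists_pos_of_eventually (eventually_smul_mem hfull y)

theorem zero_mem_quo (hfull : (interior S.P).Nonempty) : 0 ∈ S.quo K :=
  ⟨interior_subset (zero_mem_interior hfull), fun k _ => by simp⟩

theorem interior_quo_nonempty (hfull : (interior S.P).Nonempty) :
    (interior (S.quo K)).Nonempty := by
  obtain ⟨t, ht, h⟩ := exists_smul_mem hfull (∑ i, S.fund i)
  refine ⟨t • ∑ i, S.fund i, ?_⟩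
  rw [interior_inter]
  refine ⟨h, mem_interior.2 ⟨⋂ k ∈ K, {x : V | 0 < ⟪x, S.α k⟫}, ?_, ?_, ?_⟩⟩
  · exact fun x hx k hk => (Set.mem_iInter₂.1 hx k hk : 0 < ⟪x, S.α k⟫).le
  · exact (Set.toFinite K).isOpen_biInter fun k _ => isOpen_lt continuous_const (by fun_prop)
  · refine Set.mem_iInter₂.2 fun k _ => ?_
    simpa [inner_smul_left, sum_inner, RootSystemData.inner_fund_α] using ht

theorem smul_fund_mem_quo {t : ℝ} (ht : 0 < t) {i : Fin n}
    (h : t • S.fund i ∈ interior S.P) : t • S.fund i ∈ S.quo K := by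
  refine ⟨interior_subset h, fun k _ => ?_⟩
  rw [inner_smul_left, RootSystemData.inner_fund_α]
  split_ifs <;> simp [ht.le]

theorem isOutwardNormal_wall (hfull : (interior S.P).Nonempty) {k : Fin n} (hk : k ∈ K) :
    IsOutwardNormal (S.quo K) (S.wall K k) (-‖S.α k‖⁻¹ • S.α k) := by
  have hpos : 0 < ‖S.α k‖⁻¹ := inv_pos.2 (norm_pos_iff.2 (S.hR_ne0 _ (S.hα_mem k)))
  refine ⟨by simp [norm_smul, S.hR_ne0 _ (S.hα_mem k)], ?_⟩
  ext x
  simp only [wall, Set.mem_ofPred_eq, inner_smul_left, RCLike.conj_to_real, and_congr_right_iff,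
    neg_mul, neg_le_neg_iff, mul_le_mul_iff_right₀ hpos]
  refine fun hx => ⟨fun h y hy => ?_, fun h => le_antisymm ?_ (hx.2 k hk)⟩
  · rw [real_inner_comm, h, real_inner_comm]
    exact hy.2 k hk
  · simpa [real_inner_comm] using h 0 (zero_mem_quo hfull)

theorem isFacet_wall (hfull : (interior S.P).Nonempty) {k : Fin n} (hk : k ∈ K) :
    IsFacet (S.quo K) (S.wall K k) := by
  have h := isOutwardNormal_wall hfull hk
  rw [h.isFacet_iff]
  refine h.vectorSpan_le.antisymm fun y hy => ?_
  rw [Submodule.mem_orthogonal_singleton_iff_inner_left, inner_smul_right, mul_eq_zero] at hy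
  have hy : ⟪y, S.α k⟫ = 0 := hy.resolve_left
    (neg_ne_zero.2 (inv_ne_zero (norm_ne_zero_iff.2 (S.hR_ne0 _ (S.hα_mem k)))))
  rw [S.expand_fund y]
  refine Submodule.sum_mem _ fun i _ => ?_
  rcases eq_or_ne i k with rfl | hik
  · simp [hy]
  · refine Submodule.smul_mem _ _ ?_
    obtain ⟨t, ht, hmem⟩ := exists_smul_mem hfull (S.fund i)
    have h1 : t • S.fund i ∈ S.wall K k := ⟨smul_fund_mem_quo ht hmem, by
      rw [inner_smul_left, RootSystemData.inner_fund_α, if_neg hik, mul_zero]⟩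
    have h2 := vsub_mem_vectorSpan ℝ h1
      (⟨zero_mem_quo hfull, inner_zero_left _⟩ : (0 : V) ∈ S.wall K k)
    rw [vsub_eq_sub, sub_zero] at h2
    exact (Submodule.smul_mem_iff _ ht.ne').1 h2

theorem normalVec_wall (hfull : (interior S.P).Nonempty) {k : Fin n} (hk : k ∈ K) :
    normalVec (S.quo K) (S.wall K k) = -‖S.α k‖⁻¹ • S.α k :=
  (isFacet_wall hfull hk).normalVec_eq (interior_quo_nonempty hfull)
    ⟨0, zero_mem_quo hfull, inner_zero_left _⟩ (isOutwardNormal_wall hfull hk)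

section ChamberFacet

variable {F : Set V}

theorem exists_pos_mem_facet (hfull : (interior S.P).Nonempty) (hnd : S.Nondegenerate)
    (hF : IsFacet S.P F) (hne : F.Nonempty) (hK : normalVec S.P F ∈ cham S.α K) :
    ∃ x ∈ F, ∀ k ∈ K, 0 < ⟪x, S.α k⟫ := by
  obtain ⟨x, -, hpos, h⟩ := exists_pos_mem (K := K) hfull hnd (T := {⟨F, hF⟩})
    (by simpa using hne) (by simpa using hK)
  exact ⟨x, h ⟨F, hF⟩ (Finset.mem_singleton_self _), hpos⟩

theorem isFacet_inter_cham (hfull : (interior S.P).Nonempty) (hnd : S.Nondegenerate)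
    (hF : IsFacet S.P F) (hK : normalVec S.P F ∈ cham S.α K) :
    IsFacet (S.quo K) (F ∩ cham S.α K) := by
  rcases F.eq_empty_or_nonempty with rfl | hne
  · rw [Set.empty_inter]
    exact ⟨fun h => absurd h Set.not_nonempty_empty, hF.2⟩
  obtain ⟨x, hx, hpos⟩ := exists_pos_mem_facet hfull hnd hF hne hK
  have hn := hF.normalVec_spec hfull hne
  have h := isOutwardNormal_inter_cham hn hx hpos
  rw [h.isFacet_iff]
  refine h.vectorSpan_le.antisymm ?_
  rw [← hn.isFacet_iff.1 hF, vectorSpan_eq_span_vsub_set_right ℝ hx, Submodule.span_le]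
  rintro _ ⟨y, hy, rfl⟩
  obtain ⟨t, ht, h1⟩ := exists_pos_of_eventually
    (eventually_mem_inter_cham (hF.1.convex S.convex_P) hx hy hpos)
  have h2 := vsub_mem_vectorSpan ℝ h1 ⟨hx, fun k hk => (hpos k hk).le⟩
  rw [vsub_eq_sub, add_sub_cancel_left] at h2
  exact (Submodule.smul_mem_iff _ ht.ne').1 h2

theorem normalVec_inter_cham (hfull : (interior S.P).Nonempty) (hnd : S.Nondegenerate)
    (hF : IsFacet S.P F) (hK : normalVec S.P F ∈ cham S.α K) :
    normalVec (S.quo K) (F ∩ cham S.α K) = normalVec S.P F := by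
  rcases F.eq_empty_or_nonempty with rfl | hne
  · rw [Set.empty_inter, normalVec_empty S.isCompact_P (hfull.mono interior_subset),
      normalVec_empty (S.isCompact_quo K) ⟨0, zero_mem_quo hfull⟩]
  · obtain ⟨x, hx, hpos⟩ := exists_pos_mem_facet hfull hnd hF hne hK
    exact (isFacet_inter_cham hfull hnd hF hK).normalVec_eq (interior_quo_nonempty hfull)
      ⟨x, hx, fun k hk => (hpos k hk).le⟩
      (isOutwardNormal_inter_cham (hF.normalVec_spec hfull hne) hx hpos)

end ChamberFacet

theorem eq_wall (hfull : (interior S.P).Nonempty) {F : Set V} (hF : IsFacet (S.quo K) F)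
    (hne : F.Nonempty) {k : Fin n} (h : ∀ x ∈ F, ⟪x, S.α k⟫ = 0) : F = S.wall K k := by
  have hn := hF.normalVec_spec (interior_quo_nonempty hfull) hne
  set u := normalVec (S.quo K) F
  have hle : (ℝ ∙ u)ᗮ ≤ (ℝ ∙ S.α k)ᗮ := by
    rw [← hn.isFacet_iff.1 hF]
    exact vectorSpan_le_orthogonal (c := 0) fun x hx => by rw [real_inner_comm, h x hx]
  obtain ⟨c, hc⟩ := Submodule.mem_span_singleton.1
    (Submodule.orthogonal_le_orthogonal_iff.1 hle (Submodule.mem_span_singleton_self _))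
  have hc0 : c ≠ 0 := by
    rintro rfl
    rw [zero_smul] at hc
    exact S.hR_ne0 _ (S.hα_mem k) hc.symm
  have hinner (x : V) : ⟪x, S.α k⟫ = c * ⟪u, x⟫ := by
    rw [← hc, inner_smul_right, real_inner_comm]
  obtain ⟨x0, hx0⟩ := hne
  have hzero : ⟪u, x0⟫ = 0 := by
    have := h x0 hx0
    rw [hinner, mul_eq_zero] at this
    exact this.resolve_left hc0
  have hx0' := hx0
  rw [hn.2] at hx0'
  refine Set.Subset.antisymm (fun x hx => ⟨hF.1.subset hx, h x hx⟩) fun x hx => ?_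
  have hx2 : ⟪u, x⟫ = 0 := by
    have := hx.2
    rw [hinner, mul_eq_zero] at this
    exact this.resolve_left hc0
  rw [hn.2]
  exact ⟨hx.1, fun y hy => by rw [hx2, ← hzero]; exact hx0'.2 y hy⟩

theorem exists_eq_inter_cham (hfull : (interior S.P).Nonempty) {F : Set V}
    (hF : IsFacet (S.quo K) F) {x : V} (hx : x ∈ F) (hpos : ∀ k ∈ K, 0 < ⟪x, S.α k⟫) :
    ∃ H, IsFacet S.P H ∧ normalVec S.P H ∈ cham S.α K ∧ F = H ∩ cham S.α K := by
  have hn := hF.normalVec_spec (interior_quo_nonempty hfull) ⟨x, hx⟩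
  set u := normalVec (S.quo K) F
  have hxF := hx
  rw [hn.2] at hxF
  have hmax (y : V) (hy : y ∈ S.P) : ⟪u, y⟫ ≤ ⟪u, x⟫ := by
    obtain ⟨t, ht, h1⟩ := exists_pos_of_eventually
      (eventually_mem_inter_cham S.convex_P hxF.1.1 hy hpos)
    have h2 := hxF.2 _ h1
    rw [inner_add_right, inner_smul_right, inner_sub_right] at h2
    nlinarith
  let H : Set V := {x ∈ S.P | ∀ y ∈ S.P, ⟪u, y⟫ ≤ ⟪u, x⟫}
  have hH : IsOutwardNormal S.P H u := ⟨hn.1, rfl⟩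
  have hxH : x ∈ H := ⟨hxF.1.1, hmax⟩
  have heq : F = H ∩ cham S.α K := by
    rw [(isOutwardNormal_inter_cham hH hxH hpos).2]
    exact hn.2
  have hfacet : IsFacet S.P H := by
    rw [hH.isFacet_iff]
    refine hH.vectorSpan_le.antisymm ?_
    rw [← hn.isFacet_iff.1 hF]
    exact vectorSpan_mono ℝ (heq.trans_subset Set.inter_subset_left)
  refine ⟨H, hfacet, ?_, heq⟩
  rw [hfacet.normalVec_eq hfull ⟨x, hxH⟩ hH]
  exact mem_cham_of_isMax hxF.1.1 hmax hpos

variable (K) in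
/-- The facets of the quotient polytope: chamber facets of `P` and walls. -/
def facetMap (hfull : (interior S.P).Nonempty) (hnd : S.Nondegenerate) :
    S.chamFacets K ⊕ K → Facets (S.quo K) :=
  Sum.elim (fun F => ⟨F.1.1 ∩ cham S.α K, isFacet_inter_cham hfull hnd F.1.2 F.2⟩)
    fun k => ⟨S.wall K k, isFacet_wall hfull k.2⟩

theorem facetMap_bijective (hfull : (interior S.P).Nonempty) (hnd : S.Nondegenerate) :
    Function.Bijective (facetMap K hfull hnd) := by
  constructor
  · have hwall (F : S.chamFacets K) (k : K) :
        (F.1.1 ∩ cham S.α K : Set V) ≠ S.wall K k := by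
      intro h
      have h0 : (0 : V) ∈ F.1.1 ∩ cham S.α K := by
        rw [h]
        exact ⟨zero_mem_quo hfull, inner_zero_left _⟩
      obtain ⟨x, hx, hpos⟩ := exists_pos_mem_facet hfull hnd F.1.2 ⟨0, h0.1⟩ F.2
      have hxw : x ∈ S.wall K k := h ▸ ⟨hx, fun k hk => (hpos k hk).le⟩
      exact (hpos k k.2).ne' hxw.2
    rintro (F | k) (H | l) h
    · have h' : (F.1.1 ∩ cham S.α K : Set V) = H.1.1 ∩ cham S.α K := congrArg Subtype.val h
      have hnorm : normalVec S.P F.1.1 = normalVec S.P H.1.1 := by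
        rw [← normalVec_inter_cham hfull hnd F.1.2 F.2, h',
          normalVec_inter_cham hfull hnd H.1.2 H.2]
      refine congrArg Sum.inl (Subtype.ext (Subtype.ext ?_))
      have key (F H : S.chamFacets K)
          (h : (F.1.1 ∩ cham S.α K : Set V) = H.1.1 ∩ cham S.α K) (hne : F.1.1.Nonempty) :
          H.1.1.Nonempty := by
        obtain ⟨x, hx, hpos⟩ := exists_pos_mem_facet hfull hnd F.1.2 hne F.2
        have : x ∈ H.1.1 ∩ cham S.α K := h ▸ ⟨hx, fun k hk => (hpos k hk).le⟩
        exact ⟨x, this.1⟩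
      rcases Set.eq_empty_or_nonempty F.1.1 with h1 | h1
      · rcases Set.eq_empty_or_nonempty H.1.1 with h2 | h2
        · rw [h1, h2]
        · exact absurd (key H F h'.symm h2) (by rw [h1]; exact Set.not_nonempty_empty)
      · rw [(F.1.2.normalVec_spec hfull h1).2, (H.1.2.normalVec_spec hfull (key F H h' h1)).2,
          hnorm]
    · exact absurd (congrArg Subtype.val h) (hwall F l)
    · exact absurd (congrArg Subtype.val h).symm (hwall H k)
    · have h' : S.wall K k = S.wall K l := congrArg Subtype.val h
      by_contra hkl
      have hkl : (l : Fin n) ≠ k := fun h => hkl (congrArg Sum.inr (Subtype.ext h.symm))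
      obtain ⟨t, ht, hmem⟩ := exists_smul_mem hfull (S.fund l)
      have h1 : t • S.fund l ∈ S.wall K k := ⟨smul_fund_mem_quo ht hmem, by
        rw [inner_smul_left, RootSystemData.inner_fund_α, if_neg hkl, mul_zero]⟩
      rw [h'] at h1
      have h2 := h1.2
      rw [inner_smul_left, RootSystemData.inner_fund_α, if_pos rfl] at h2
      exact absurd h2 (by simpa using ht.ne')
  · rintro ⟨F, hF⟩
    rcases F.eq_empty_or_nonempty with rfl | hne
    · have h0 : IsFacet S.P ∅ := ⟨fun h => absurd h Set.not_nonempty_empty, hF.2⟩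
      refine ⟨Sum.inl ⟨⟨∅, h0⟩, ?_⟩, Subtype.ext (Set.empty_inter _)⟩
      change normalVec S.P ∅ ∈ cham S.α K
      rw [normalVec_empty S.isCompact_P (hfull.mono interior_subset)]
      exact fun k _ => by simp
    · by_cases h : ∀ k ∈ K, ∃ x ∈ F, ⟪x, S.α k⟫ ≠ 0
      · obtain ⟨x, hx, hpos⟩ := exists_pos_of_not_subset_wall
          (hF.1.convex (S.convex_P.inter (convex_cham _ _))) hne hF.1.subset h
        obtain ⟨H, hH, hHK, rfl⟩ := exists_eq_inter_cham hfull hF hx hpos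
        exact ⟨Sum.inl ⟨⟨H, hH⟩, hHK⟩, rfl⟩
      · push Not at h
        obtain ⟨k, hk, h⟩ := h
        exact ⟨Sum.inr ⟨k, hk⟩, Subtype.ext (eq_wall hfull hF hne h).symm⟩

theorem inter_wall_eq_empty (hfull : (interior S.P).Nonempty) (hnd : S.Nondegenerate)
    {F : Set V} (hF : IsFacet S.P F) (hK : normalVec S.P F ∈ cham S.α K) {k : Fin n} (hk : k ∈ K)
    (h : ⟪normalVec S.P F, S.α k⟫ ≠ 0) : F ∩ S.wall K k = ∅ := by
  by_contra! hne
  obtain ⟨x, hx, hxw⟩ := hne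
  have hr := RootSystemData.reflIso_mem (S := S.toRootSystemData) hk
  classical
  have hrF := hF.map _ hfull (image_P hr)
  obtain ⟨g, hg, y, -, -, hgT⟩ := exists_image_mem_cham (K := K) hfull hnd
    (T := {⟨F, hF⟩, ⟨reflIso (S.α k) '' F, hrF⟩}) ⟨x, by
      simpa using ⟨hx, x, hx, reflIso_eq_self hxw.2⟩⟩
  have h1 := image_eq_self hfull hg hF hK (hgT ⟨F, hF⟩ (by simp)).2
  have h2 := (hgT ⟨reflIso (S.α k) '' F, hrF⟩ (by simp)).2
  dsimp only at h2
  have h3 := image_eq_self hfull (mul_mem hg hr) hF hK (by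
    rwa [LinearIsometryEquiv.coe_mul, Set.image_comp])
  rw [LinearIsometryEquiv.coe_mul, Set.image_comp] at h3
  have h4 : reflIso (S.α k) '' F = F := g.injective.image_injective (h3.trans h1.symm)
  refine h (inner_eq_zero_of_reflIso_eq_self ?_)
  rw [← normalVec_image hfull hr hF, h4]

theorem exists_mem_walls (hfull : (interior S.P).Nonempty) (hnd : S.Nondegenerate)
    {T : Finset (Facets S.P)} (hT : (⋂ F ∈ T, F.1).Nonempty)
    (hTK : ∀ F ∈ T, normalVec S.P F.1 ∈ cham S.α K) {J : Set (Fin n)} (hJ : J ⊆ K)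
    (horth : ∀ F ∈ T, ∀ j ∈ J, ⟪normalVec S.P F.1, S.α j⟫ = 0) :
    ∃ y ∈ S.quo K, (∀ F ∈ T, y ∈ F.1) ∧ ∀ j ∈ J, ⟪y, S.α j⟫ = 0 := by
  obtain ⟨x, hx, hpos, hxT⟩ := exists_pos_mem hfull hnd hT hTK
  have hcomp : IsCompact (S.quo K ∩ ⋂ F ∈ T, F.1) := (S.isCompact_quo K).inter_right
    (isClosed_biInter fun F _ => F.2.1.isClosed S.isCompact_P.isClosed)
  obtain ⟨y, ⟨hyQ, hyT⟩, hmin⟩ := hcomp.exists_isMinOn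
    ⟨x, ⟨hx, fun k hk => (hpos k hk).le⟩, Set.mem_iInter₂.2 hxT⟩ continuous_norm.continuousOn
  have hyT := Set.mem_iInter₂.1 hyT
  refine ⟨y, hyQ, hyT, fun j hj => ?_⟩
  have hj0 : 0 < ⟪S.α j, S.α j⟫ := real_inner_self_pos.2 (S.hR_ne0 _ (S.hα_mem j))
  set c := ⟪y, S.α j⟫ / ⟪S.α j, S.α j⟫
  have hc : c * ⟪S.α j, S.α j⟫ = ⟪y, S.α j⟫ := div_mul_cancel₀ _ hj0.ne'
  have hc0 : 0 ≤ c := div_nonneg (hyQ.2 j (hJ hj)) hj0.le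
  have hmemP : y - c • S.α j ∈ S.P := by
    have h := S.convex_P hyQ.1 (apply_mem_P (RootSystemData.reflIso_mem (hJ hj)) hyQ.1)
      (a := 1 / 2) (b := 1 / 2) (by norm_num) (by norm_num) (by norm_num)
    convert h using 1
    rw [reflIso_apply, mul_div_assoc]
    module
  have hmem : y - c • S.α j ∈ S.quo K ∩ ⋂ F ∈ T, F.1 := by
    refine ⟨⟨hmemP, fun k hk => ?_⟩, Set.mem_iInter₂.2 fun F hF => ?_⟩
    · rw [inner_sub_left, inner_smul_left, RCLike.conj_to_real]
      rcases eq_or_ne j k with rfl | hjk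
      · rw [hc, sub_self]
      · have := mul_nonneg hc0 (neg_nonneg.2 (RootSystemData.inner_α_nonpos (S := S.toRootSystemData) hjk))
        linarith [hyQ.2 k hk]
    · have hn := F.2.normalVec_spec hfull ⟨y, hyT F hF⟩
      have hy := hyT F hF
      rw [hn.2] at hy ⊢
      refine ⟨hmemP, fun z hz => (hy.2 z hz).trans_eq ?_⟩
      rw [inner_sub_right, inner_smul_right, horth F hF j hj, mul_zero, sub_zero]
  have hle : ‖y‖ ≤ ‖y - c • S.α j‖ := hmin hmem
  have hsq : ‖y - c • S.α j‖ ^ 2 = ‖y‖ ^ 2 - c * ⟪y, S.α j⟫ := by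
    rw [norm_sub_sq_real, inner_smul_right, norm_smul, mul_pow, Real.norm_eq_abs, sq_abs,
      ← real_inner_self_eq_norm_sq (S.α j), ← hc]
    ring
  have h1 : ‖y‖ ^ 2 ≤ ‖y - c • S.α j‖ ^ 2 := by gcongr
  rw [hsq, ← hc] at h1
  have h2 : c * (c * ⟪S.α j, S.α j⟫) ≤ 0 := by linarith
  have h3 : c = 0 := by
    by_contra h
    have : 0 < c * (c * ⟪S.α j, S.α j⟫) := by
      have := hc0.lt_of_ne' h
      positivity
    linarith
  rw [← hc, h3, zero_mul]

end PermSetup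

/-! ### The polytopal algebras of `P` and of the quotient polytope -/

namespace PermSetup

open MvPolynomial

variable {n : ℕ} {S : PermSetup V n} {K : Set (Fin n)} [FiniteDimensional ℝ V]

theorem polyIdeal_P (hfull : (interior S.P).Nonempty) (hnd : S.Nondegenerate)
    [Fintype (Facets S.P)] :
    letI := facetAction K hfull
    polyIdeal S.P = (foldData K hfull hnd).ideal := by
  let := facetAction K hfull
  have h1 : srIdeal S.P = (foldData K hfull hnd).sr := by
    rw [srIdeal, FoldData.sr]
    congr 1
    ext p
    exact exists_congr fun t => and_congr_left' Set.not_nonempty_iff_eq_empty.symm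
  have h2 : linIdeal S.P = (foldData K hfull hnd).linI := by
    rw [linIdeal, FoldData.linI]
    congr 1
    ext p
    refine exists_congr fun u => ?_
    rw [finsum_eq_sum_of_fintype]
    rfl
  rw [polyIdeal, h1, h2, FoldData.ideal]

variable (K) in
/-- The facets of the quotient polytope are the chamber facets and the walls. -/
def facetEquiv (hfull : (interior S.P).Nonempty) (hnd : S.Nondegenerate) :
    S.chamFacets K ⊕ K ≃ Facets (S.quo K) :=
  Equiv.ofBijective _ (facetMap_bijective hfull hnd)

theorem polyIdeal_quo (hfull : (interior S.P).Nonempty) (hnd : S.Nondegenerate)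
    [Fintype (S.chamFacets K)] [Fintype K] :
    letI := facetAction K hfull
    letI : Fintype (foldData K hfull hnd).D := inferInstanceAs (Fintype (S.chamFacets K))
    polyIdeal (S.quo K) = (foldData K hfull hnd).idealQ (facetEquiv K hfull hnd) := by
  classical
  let := facetAction K hfull
  let : Fintype (foldData K hfull hnd).D := inferInstanceAs (Fintype (S.chamFacets K))
  let e := facetEquiv K hfull hnd
  have hinl (F : S.chamFacets K) : (e (.inl F)).1 = F.1.1 ∩ cham S.α K := rfl
  have hinr (k : K) : (e (.inr k)).1 = S.wall K k := rfl
  let : Fintype (Facets (S.quo K)) := Fintype.ofEquiv _ e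
  have hlin (u : V) : (∑ᶠ F : Facets (S.quo K),
      C ⟪u, normalVec (S.quo K) F.1⟫ * (X F : MvPolynomial _ ℝ)) =
      (foldData K hfull hnd).linQ e u := by
    change _ = ∑ F : S.chamFacets K, C ⟪u, normalVec S.P F.1.1⟫ * X (e (.inl F)) -
      ∑ k : K, C (⟪u, S.α k⟫ * ‖S.α k‖⁻¹) * X (e (.inr k))
    rw [finsum_eq_sum_of_fintype, ← e.sum_comp, Fintype.sum_sum_type, sub_eq_add_neg,
      ← Finset.sum_neg_distrib]
    refine congrArg₂ _ (Finset.sum_congr rfl fun F _ => ?_) (Finset.sum_congr rfl fun k _ => ?_)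
    · rw [hinl, normalVec_inter_cham hfull hnd F.1.2 F.2]
    · rw [hinr, normalVec_wall hfull k.2, inner_smul_right, ← neg_mul, ← C_neg, ← mul_neg,
        mul_comm (-_)]
  apply le_antisymm
  · refine sup_le (Ideal.span_le.2 ?_) (Ideal.span_le.2 ?_)
    · rintro _ ⟨t, ht, rfl⟩
      by_cases hpair : ∃ (F : S.chamFacets K) (k : K), e (.inl F) ∈ t ∧ e (.inr k) ∈ t ∧
          ⟪normalVec S.P F.1.1, S.α k⟫ ≠ 0
      · obtain ⟨F, k, hF, hk, h⟩ := hpair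
        have hne : e (.inl F) ≠ e (.inr k) := by simp
        refine Ideal.mem_of_dvd _ ?_ (Ideal.subset_span (Or.inl (Or.inr ⟨F, k, h, rfl⟩)))
        change X (e (.inl F)) * X (e (.inr k)) ∣ _
        rw [← Finset.prod_pair hne]
        exact Finset.prod_dvd_prod_of_subset _ _ _ (by
          simp only [Finset.insert_subset_iff, Finset.singleton_subset_iff]
          exact ⟨hF, hk⟩)
      · push Not at hpair
        let T : Finset (S.chamFacets K) := {F | e (.inl F) ∈ t}
        have hT : ¬ (⋂ F ∈ T.map (Function.Embedding.subtype _), F.1).Nonempty := by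
          intro hne
          obtain ⟨y, hyQ, hyT, hyJ⟩ := exists_mem_walls (K := K) hfull hnd hne
            (by
              intro F hF
              obtain ⟨H, -, rfl⟩ := Finset.mem_map.1 hF
              exact H.2)
            (J := {j | ∃ k : K, k = j ∧ e (.inr k) ∈ t})
            (by
              rintro _ ⟨k, rfl, -⟩
              exact k.2)
            (by
              rintro F hF _ ⟨k, rfl, hk⟩
              obtain ⟨H, hH, rfl⟩ := Finset.mem_map.1 hF
              exact hpair H k (Finset.mem_filter.1 hH).2 hk)
          rw [← Set.not_nonempty_iff_eq_empty] at ht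
          refine ht ⟨y, Set.mem_iInter₂.2 fun H hH => ?_⟩
          obtain ⟨F | k, rfl⟩ := e.surjective H
          · rw [hinl]
            exact ⟨hyT F.1 (Finset.mem_map.2
              ⟨F, Finset.mem_filter.2 ⟨Finset.mem_univ _, hH⟩, rfl⟩), hyQ.2⟩
          · rw [hinr]
            exact ⟨hyQ, hyJ k ⟨k, rfl, hH⟩⟩
        refine Ideal.mem_of_dvd _ ?_ (Ideal.subset_span (Or.inl (Or.inl ⟨T, hT, rfl⟩)))
        change ∏ F ∈ T, X (e (.inl F)) ∣ _
        rw [← Finset.prod_image (s := T) (g := fun F : S.chamFacets K => e (.inl F))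
          (f := fun H => (X H : MvPolynomial (Facets (S.quo K)) ℝ)) (by
            intro F _ H _ h
            exact Sum.inl_injective (e.injective h))]
        refine Finset.prod_dvd_prod_of_subset _ _ _ fun H hH => ?_
        obtain ⟨F, hF, rfl⟩ := Finset.mem_image.1 hH
        exact (Finset.mem_filter.1 hF).2
    · rintro _ ⟨u, rfl⟩
      rw [hlin]
      exact Ideal.subset_span (Or.inr ⟨u, rfl⟩)
  · refine Ideal.span_le.2 ?_
    rintro _ ((⟨T, hT, rfl⟩ | ⟨F, k, h, rfl⟩) | ⟨u, rfl⟩)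
    · refine Ideal.mem_sup_left (Ideal.subset_span
        ⟨T.image fun F : S.chamFacets K => e (.inl F), ?_, ?_⟩)
      · refine Set.not_nonempty_iff_eq_empty.1 fun ⟨x, hx⟩ => hT ⟨x, Set.mem_iInter₂.2 ?_⟩
        intro F hF
        obtain ⟨H, hH, rfl⟩ := Finset.mem_map.1 hF
        exact (Set.mem_iInter₂.1 hx (e (.inl H)) (Finset.mem_image_of_mem _ hH)).1
      · exact (Finset.prod_image (fun F _ H _ h => Sum.inl_injective (e.injective h))).symm
    · have hne : e (.inl F) ≠ e (.inr k) := by simp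
      refine Ideal.mem_sup_left (Ideal.subset_span
        ⟨{e (.inl F), e (.inr k)}, ?_, (Finset.prod_pair hne).symm⟩)
      refine Set.eq_empty_of_subset_empty fun x hx => ?_
      have h1 := Set.mem_iInter₂.1 hx (e (.inl F)) (by simp)
      have h2 := Set.mem_iInter₂.1 hx (e (.inr k)) (by simp)
      rw [← inter_wall_eq_empty hfull hnd F.1.2 F.2 k.2 h]
      exact ⟨h1.1, h2⟩
    · exact Ideal.mem_sup_right (Ideal.subset_span ⟨u, (hlin u).symm⟩)

variable (K) in
/-- The automorphism of the polynomial ring permuting the facet variables. -/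
def facetAut (hfull : (interior S.P).Nonempty) (g : S.parabolic K) :
    MvPolynomial (Facets S.P) ℝ ≃ₐ[ℝ] MvPolynomial (Facets S.P) ℝ :=
  letI := facetAction K hfull
  renameEquiv ℝ (MulAction.toPerm g)

theorem facetAut_X (hfull : (interior S.P).Nonempty) (g : S.parabolic K) (F : Facets S.P)
    (hF : IsFacet S.P ((g : V ≃ₗᵢ[ℝ] V) '' F.1)) :
    facetAut K hfull g (X F) = X ⟨(g : V ≃ₗᵢ[ℝ] V) '' F.1, hF⟩ :=
  rename_X _ _

theorem map_facetAut (hfull : (interior S.P).Nonempty) (hnd : S.Nondegenerate)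
    (g : S.parabolic K) : (polyIdeal S.P).map (facetAut K hfull g :
      MvPolynomial (Facets S.P) ℝ →+* MvPolynomial (Facets S.P) ℝ) = polyIdeal S.P := by
  let := facetAction K hfull
  have := finite_facets_P (S := S)
  let := Fintype.ofFinite (Facets S.P)
  rw [polyIdeal_P (K := K) hfull hnd]
  refine le_antisymm (Ideal.map_le_iff_le_comap.2 fun p hp => FoldData.act_ideal _ g hp) ?_
  intro p hp
  have h : facetAut K hfull g (FoldData.act (S.parabolic K) g⁻¹ p) = p := by
    change FoldData.act (S.parabolic K) g (FoldData.act (S.parabolic K) g⁻¹ p) = p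
    rw [FoldData.act_act, mul_inv_cancel, FoldData.act_one]
  rw [← h]
  exact Ideal.mem_map_of_mem _ (FoldData.act_ideal _ g⁻¹ hp)

variable (K) in
/-- The action of the parabolic subgroup on the polytopal algebra. -/
def polyAlgAction (hfull : (interior S.P).Nonempty) (hnd : S.Nondegenerate) :
    S.parabolic K →* (PolyAlg S.P ≃ₐ[ℝ] PolyAlg S.P) where
  toFun g := Ideal.quotientEquivAlg _ _ (facetAut K hfull g) (map_facetAut hfull hnd g).symm
  map_one' := by
    let := facetAction K hfull
    ext x
    obtain ⟨p, rfl⟩ := Ideal.Quotient.mk_surjective x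
    exact congrArg (Ideal.Quotient.mk _) (FoldData.act_one (G := S.parabolic K) p)
  map_mul' g h := by
    let := facetAction K hfull
    ext x
    obtain ⟨p, rfl⟩ := Ideal.Quotient.mk_surjective x
    exact congrArg (Ideal.Quotient.mk _) (FoldData.act_act g h p).symm

variable (S K) in
/-- The identification of the monoid `WK` with the parabolic subgroup. -/
def WKHom : WK S.α K →* S.parabolic K where
  toFun s := ⟨(RootSystemData.mem_WK.1 s.2).choose, (RootSystemData.mem_WK.1 s.2).choose_spec.1⟩
  map_one' := Subtype.ext (DFunLike.coe_injective
    (RootSystemData.mem_WK.1 (1 : WK S.α K).2).choose_spec.2)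
  map_mul' s t := Subtype.ext (DFunLike.coe_injective
    ((RootSystemData.mem_WK.1 (s * t).2).choose_spec.2.trans
      (congrArg₂ (fun f g : Function.End V => f * g)
        (RootSystemData.mem_WK.1 s.2).choose_spec.2
        (RootSystemData.mem_WK.1 t.2).choose_spec.2).symm))

omit [FiniteDimensional ℝ V] in
theorem coe_WKHom (s : WK S.α K) : ⇑(S.WKHom K s : V ≃ₗᵢ[ℝ] V) = (s : Function.End V) :=
  (RootSystemData.mem_WK.1 s.2).choose_spec.2

omit [FiniteDimensional ℝ V] in
theorem WKHom_surjective : Function.Surjective (S.WKHom K) := fun g =>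
  ⟨⟨_, RootSystemData.mem_WK.2 ⟨g, g.2, rfl⟩⟩, Subtype.ext (DFunLike.coe_injective (coe_WKHom _))⟩

theorem nonempty_algEquiv_invariants (hfull : (interior S.P).Nonempty) (hnd : S.Nondegenerate) :
    Nonempty (PolyAlg (S.quo K) ≃ₐ[ℝ]
      invariants ((polyAlgAction K hfull hnd).comp (S.WKHom K))) := by
  classical
  let := facetAction K hfull
  have := finite_facets_P (S := S)
  let := Fintype.ofFinite (Facets S.P)
  let := Fintype.ofFinite (S.chamFacets K)
  let := Fintype.ofFinite K
  let := Fintype.ofFinite (S.parabolic K)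
  let : Fintype (foldData K hfull hnd).D := inferInstanceAs (Fintype (S.chamFacets K))
  refine (foldData K hfull hnd).nonempty_algEquiv (facetEquiv K hfull hnd)
    (polyIdeal_P hfull hnd) (polyIdeal_quo hfull hnd) _ fun p => ?_
  change (∀ s : WK S.α K, polyAlgAction K hfull hnd (S.WKHom K s) (Ideal.Quotient.mk _ p) =
    Ideal.Quotient.mk _ p) ↔ _
  rw [← WKHom_surjective.forall (p := fun g : S.parabolic K =>
    polyAlgAction K hfull hnd g (Ideal.Quotient.mk _ p) = Ideal.Quotient.mk _ p)]
  exact forall_congr' fun g => Ideal.Quotient.eq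

end PermSetup

/-- Theorem 1.3: for a nondegenerate simple `W`-symmetric polytope `P` and a parabolic
subgroup `W_K`, (i) `W_K` acts on the polytopal algebra `𝒜(P)` by `ℝ`-algebra
automorphisms induced by `X_F ↦ X_{s(F)}`, and (ii) `P ∩ C_K` is a full-dimensional
polytope and `𝒜(P ∩ C_K) ≅ 𝒜(P)^{W_K}` as `ℝ`-algebras. -/
theorem statement_0 {V : Type*} [NormedAddCommGroup V] [InnerProductSpace ℝ V]
    [FiniteDimensional ℝ V] {n : ℕ} (S : PermSetup V n)
    (hfull : (interior S.P).Nonempty) (hnd : S.Nondegenerate) (hsimple : IsSimple S.P)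
    (K : Set (Fin n)) :
    -- (i): each `s ∈ W_K` permutes facets, transforms normals accordingly, and the
    -- variable-renaming automorphism preserves the ideal `I_P + J_P`
    (∀ s ∈ WK S.α K,
      (∀ F : Set V, IsFacet S.P F → IsFacet S.P (Set.image s F) ∧
        s (normalVec S.P F) = normalVec S.P (Set.image s F)) ∧
      ∃ σ : MvPolynomial (Facets S.P) ℝ ≃ₐ[ℝ] MvPolynomial (Facets S.P) ℝ,
        (∀ F : Facets S.P, ∃ hF : IsFacet S.P (Set.image s F.1),
          σ (MvPolynomial.X F) = MvPolynomial.X ⟨Set.image s F.1, hF⟩) ∧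
        Ideal.map (σ : MvPolynomial (Facets S.P) ℝ →+* MvPolynomial (Facets S.P) ℝ)
          (polyIdeal S.P) = polyIdeal S.P) ∧
    -- (ii): `P ∩ C_K` is a full-dimensional polytope and `𝒜(P ∩ C_K) ≅ 𝒜(P)^{W_K}`
    ((∃ B : Set V, B.Finite ∧ S.P ∩ cham S.α K = convexHull ℝ B) ∧
     (interior (S.P ∩ cham S.α K)).Nonempty ∧
     ∃ ρ : ↥(WK S.α K) →* (PolyAlg S.P ≃ₐ[ℝ] PolyAlg S.P),
       (∀ (s : ↥(WK S.α K)) (F : Facets S.P)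
          (hF : IsFacet S.P (Set.image (s : Function.End V) F.1)),
          ρ s (polyMk S.P (MvPolynomial.X F)) =
            polyMk S.P (MvPolynomial.X ⟨Set.image (s : Function.End V) F.1, hF⟩)) ∧
       Nonempty ((PolyAlg (S.P ∩ cham S.α K)) ≃ₐ[ℝ] ↥(invariants ρ))) := by
  refine ⟨fun s hs => ?_, ?_, S.interior_quo_nonempty hfull, ?_⟩
  · obtain ⟨g, hg, rfl⟩ := RootSystemData.mem_WK.1 hs
    have hF (F : Set V) (h : IsFacet S.P F) : IsFacet S.P (g '' F) :=
      h.map g hfull (PermSetup.image_P hg)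
    exact ⟨fun F h => ⟨hF F h, (PermSetup.normalVec_image hfull hg h).symm⟩,
      PermSetup.facetAut K hfull ⟨g, hg⟩,
      fun F => ⟨hF F.1 F.2, PermSetup.facetAut_X hfull ⟨g, hg⟩ F _⟩,
      PermSetup.map_facetAut hfull hnd ⟨g, hg⟩⟩
  · obtain ⟨B, hB, h⟩ := S.exists_finite_P
    rw [h]
    exact exists_finite_inter_cham hB S.α K
  · refine ⟨(PermSetup.polyAlgAction K hfull hnd).comp (S.WKHom K), fun s F hF => ?_,
      PermSetup.nonempty_algEquiv_invariants hfull hnd⟩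
    have h : (S.WKHom K s : V ≃ₗᵢ[ℝ] V) '' F.1 = Set.image (s : Function.End V) F.1 := by
      rw [PermSetup.coe_WKHom]
    refine (congrArg (polyMk S.P)
      (PermSetup.facetAut_X hfull (S.WKHom K s) F (h.symm ▸ hF))).trans ?_
    exact congrArg (fun H => polyMk S.P (MvPolynomial.X H)) (Subtype.ext h)
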